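/- arXiv:1608.02022 — 4 statements merged into one kernel-verified Lean document; each statement's English description precedes it below -/
import Mathlib

section
/- The set of all sums p₆(x₁) + p₆(x₂) + p₆(x₃) + p₆(x₄) with x₁, x₂, x₃, x₄ nonnegative integers equals the set of all nonnegative integers except 5, 10, 11, 20, 25, 26, 38, 39, 54, 65, 70, 114, 130. -/
/-- Centered remainder: shift `b` by a multiple of `a` to make it small. -/
lemma centered_shift (a b : ℤ) (ha : 0 < a) : ∃ k : ℤ, 2 * (b + a * k) ≤ a ∧ -a ≤ 2 * (b + a * k) := by
  refine ⟨-((2 * b + a) / (2 * a)), ?_, ?_⟩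
  · have h1 := Int.lt_ediv_add_one_mul_self (2 * b + a) (show (0:ℤ) < 2 * a by omega)
    nlinarith
  · have h2 := Int.ediv_mul_le (2 * b + a) (show (2 * a : ℤ) ≠ 0 by omega)
    nlinarith

/-- Reduction of binary forms. -/
lemma binary_reduce (D : ℤ) (hD : 0 < D) : ∀ (n : ℕ) (A B C : ℤ), A.toNat ≤ n → 0 < A →
    A * C - B ^ 2 = D →
    ∃ p q r s : ℤ, p * s - q * r = 1 ∧ 0 < A * p ^ 2 + 2 * B * p * r + C * r ^ 2 ∧
      3 * (A * p ^ 2 + 2 * B * p * r + C * r ^ 2) ^ 2 ≤ 4 * D := by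
  intro n
  induction n with
  | zero => intro A B C h1 h2; omega
  | succ n ih =>
    intro A B C hn hA hdet
    obtain ⟨k, hk1, hk2⟩ := centered_shift A B hA
    set B' := B + A * k with hB'
    set C' := C + 2 * B * k + A * k ^ 2 with hC'
    have hdet' : A * C' - B' ^ 2 = D := by rw [hB', hC', ← hdet]; ring
    have hBsq : 4 * B' ^ 2 ≤ A ^ 2 := by nlinarith
    have hC0 : 0 < C' := by
      have : 0 < A * C' := by nlinarith [sq_nonneg B']
      exact pos_of_mul_pos_right this hA.le
    by_cases hc : A ≤ C'
    · refine ⟨1, 0, 0, 1, by ring, by nlinarith, ?_⟩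
      nlinarith
    · push Not at hc
      obtain ⟨p, q, r, s, h1, h2, h3⟩ := ih C' (-B') A (by omega) hC0 (by rw [← hdet']; ring)
      have key : A * (k * p - r) ^ 2 + 2 * B * (k * p - r) * p + C * p ^ 2
          = C' * p ^ 2 + 2 * (-B') * p * r + A * r ^ 2 := by
        rw [hB', hC']; ring
      refine ⟨k * p - r, k * q - s, p, q, by linarith, ?_, ?_⟩
      · rw [key]; exact h2
      · rw [key]; exact h3

set_option maxHeartbeats 1000000 in
/-- Positive definite ternary forms of determinant one are sums of three squares. -/
lemma ternary_reduce : ∀ (n : ℕ) (a b c d e f : ℤ), a.toNat ≤ n → 0 < a → 0 < a * d - b ^ 2 →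
    a * (d * f - e ^ 2) - b * (b * f - c * e) + c * (b * e - c * d) = 1 →
    ∀ x y z : ℤ, ∃ u v w : ℤ,
      a * x ^ 2 + 2 * b * x * y + 2 * c * x * z + d * y ^ 2 + 2 * e * y * z + f * z ^ 2
        = u ^ 2 + v ^ 2 + w ^ 2 := by
  intro n
  induction n with
  | zero => intro a b c d e f h1 h2; omega
  | succ n ih =>
    intro a b c d e f hn ha hpos hdet x y z
    obtain ⟨p, q, r, s, h1, h2, h3⟩ := binary_reduce a ha _ (a * d - b ^ 2) (a * e - b * c)
      (a * f - c ^ 2) le_rfl hpos (by linear_combination a * hdet)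
    obtain ⟨k, hk1, hk2⟩ := centered_shift a (b * p + c * r) ha
    obtain ⟨b2, hb2⟩ : ∃ b2, b2 = (b * p + c * r) + a * k := ⟨_, rfl⟩
    obtain ⟨c2, hc2⟩ : ∃ c2, c2 = b * q + c * s := ⟨_, rfl⟩
    obtain ⟨d2, hd2⟩ : ∃ d2, d2 = d * p ^ 2 + 2 * e * p * r + f * r ^ 2
      + 2 * k * (b * p + c * r) + a * k ^ 2 := ⟨_, rfl⟩
    obtain ⟨e2, he2⟩ : ∃ e2, e2 = d * p * q + e * (p * s + q * r) + f * r * s + k * c2 := ⟨_, rfl⟩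
    obtain ⟨f2, hf2⟩ : ∃ f2, f2 = d * q ^ 2 + 2 * e * q * s + f * s ^ 2 := ⟨_, rfl⟩
    obtain ⟨A, hA⟩ : ∃ A, A = (a * d - b ^ 2) * p ^ 2 + 2 * (a * e - b * c) * p * r
      + (a * f - c ^ 2) * r ^ 2 := ⟨_, rfl⟩
    rw [← hA] at h2 h3
    rw [← hb2] at hk1 hk2
    have hA2 : a * d2 - b2 ^ 2 = A := by rw [hd2, hb2, hA]; ring
    have hdet2 : a * (d2 * f2 - e2 ^ 2) - b2 * (b2 * f2 - c2 * e2) + c2 * (b2 * e2 - c2 * d2)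
        = 1 := by
      have : a * (d2 * f2 - e2 ^ 2) - b2 * (b2 * f2 - c2 * e2) + c2 * (b2 * e2 - c2 * d2)
        = (p * s - q * r) ^ 2 *
          (a * (d * f - e ^ 2) - b * (b * f - c * e) + c * (b * e - c * d)) := by
        rw [hb2, he2, hd2, hf2, hc2]; ring
      rw [this, h1, hdet]; norm_num
    -- new coordinates
    obtain ⟨Y, hY⟩ : ∃ Y, Y = s * y - q * z := ⟨_, rfl⟩
    obtain ⟨Z, hZ⟩ : ∃ Z, Z = p * z - r * y := ⟨_, rfl⟩
    obtain ⟨X, hX⟩ : ∃ X, X = x - k * Y := ⟨_, rfl⟩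
    have hx : x = X + k * Y := by rw [hX]; ring
    have hy : y = p * Y + q * Z := by rw [hY, hZ]; linear_combination (-y) * h1
    have hz : z = r * Y + s * Z := by rw [hY, hZ]; linear_combination (-z) * h1
    have hform : a * x ^ 2 + 2 * b * x * y + 2 * c * x * z + d * y ^ 2 + 2 * e * y * z + f * z ^ 2
        = a * X ^ 2 + 2 * b2 * X * Y + 2 * c2 * X * Z + d2 * Y ^ 2 + 2 * e2 * Y * Z
          + f2 * Z ^ 2 := by
      rw [he2, hb2, hd2, hf2, hc2, hx, hy, hz]; ring
    rw [hform]
    have hbsq : 4 * b2 ^ 2 ≤ a ^ 2 := by nlinarith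
    have hd0 : 0 < d2 := by
      have : 0 < a * d2 := by linarith [sq_nonneg b2]
      exact pos_of_mul_pos_right this ha.le
    by_cases hda : d2 < a
    · obtain ⟨u, v, w, huvw⟩ := ih d2 b2 e2 a c2 f2 (by omega) hd0 (by linarith)
        (by linear_combination hdet2) Y X Z
      exact ⟨u, v, w, by rw [← huvw]; ring⟩
    · push Not at hda
      have h4 : 3 * a ^ 2 ≤ 4 * A := by
        have : a * a ≤ a * d2 := mul_le_mul_of_nonneg_left hda ha.le
        linarith [sq a]
      have h5 : 9 * a ^ 4 ≤ 16 * A ^ 2 := by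
        have : (3 * a ^ 2) ^ 2 ≤ (4 * A) ^ 2 := pow_le_pow_left₀ (by positivity) h4 2
        linarith [show (3 * a ^ 2) ^ 2 = 9 * a ^ 4 by ring, show (4 * A) ^ 2 = 16 * A ^ 2 by ring]
      have ha1 : a = 1 := by
        by_contra hne
        have h6 : 2 ≤ a := by omega
        have h7 : 4 ≤ a ^ 2 := by nlinarith
        have h8 : 8 ≤ a ^ 3 := by nlinarith
        have h9 : a * 8 ≤ a * a ^ 3 := mul_le_mul_of_nonneg_left h8 ha.le
        linarith [show a * a ^ 3 = a ^ 4 by ring]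
      subst ha1
      have hb0 : b2 = 0 := by omega
      have hA1 : A = 1 := by
        by_contra hne
        have h6 : 2 ≤ A := by omega
        have h7 : (2:ℤ) ^ 2 ≤ A ^ 2 := pow_le_pow_left₀ (by norm_num) h6 2
        linarith
      subst hb0
      have hd1 : d2 = 1 := by linarith
      subst hd1
      exact ⟨X + c2 * Z, Y + e2 * Z, Z, by linear_combination Z ^ 2 * hdet2⟩

lemma three_sq_of_residue (m b N r : ℤ) (hN : N = b * m - 1) (hN0 : 0 < N) (hb : 0 < b)
    (hdvd : N ∣ r ^ 2 + b) : ∃ x y z : ℤ, m = x ^ 2 + y ^ 2 + z ^ 2 := by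
  obtain ⟨a, ha⟩ := hdvd
  have ha0 : 0 < a := by
    have : 0 < N * a := by rw [← ha]; positivity
    exact pos_of_mul_pos_right this hN0.le
  obtain ⟨u, v, w, h⟩ := ternary_reduce _ a r 1 N 0 m le_rfl ha0 (by nlinarith)
    (by linear_combination (-m) * ha - hN) 0 0 1
  exact ⟨u, v, w, by linarith⟩

lemma exists_sq_dvd (p b : ℕ) (hp : p.Prime) (h : jacobiSym (-(b:ℤ)) p = 1) :
    ∃ r : ℤ, (p : ℤ) ∣ r ^ 2 + b := by
  have := Fact.mk hp
  obtain ⟨s, hs⟩ := ZMod.isSquare_of_jacobiSym_eq_one h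
  refine ⟨(s.val : ℤ), ?_⟩
  rw [← ZMod.intCast_zmod_eq_zero_iff_dvd]
  push_cast at hs ⊢
  rw [ZMod.natCast_zmod_val, sq, ← hs]; ring

lemma three_sq_even (m : ℕ) (hm : m % 4 = 2) :
    ∃ x y z : ℤ, (m : ℤ) = x ^ 2 + y ^ 2 + z ^ 2 := by
  have hcop : (m - 1).Coprime (4 * m) := by
    apply Nat.Coprime.mul_right
    · have : Nat.Coprime (m - 1) 2 := by
        rw [Nat.coprime_two_right, Nat.odd_iff]; omega
      exact Nat.Coprime.mul_right this this
    · obtain ⟨k, rfl⟩ : ∃ k, m = k + 1 := ⟨m - 1, by omega⟩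
      simp
  obtain ⟨p, hgt, hp, hmod⟩ := Nat.forall_exists_prime_gt_and_modEq (m + 1) (by omega) hcop
  obtain ⟨v, hv⟩ := (Nat.modEq_iff_dvd' (show m - 1 ≤ p by omega)).1 hmod.symm
  have hpv : p + 1 = (4 * v + 1) * m := by
    have : p = (m - 1) + 4 * m * v := by omega
    zify [show 1 ≤ m by omega] at this ⊢
    linarith
  have hp4 : p % 4 = 1 := by
    have : p = (m - 1) + 4 * (m * v) := by rw [← mul_assoc]; omega
    omega
  have hbodd : Odd (4 * v + 1) := by rw [Nat.odd_iff]; omega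
  have hpodd : Odd p := by rw [Nat.odd_iff]; omega
  have hJ : jacobiSym (-((4 * v + 1 : ℕ):ℤ)) p = 1 := by
    rw [jacobiSym.neg _ hpodd, ZMod.χ₄_nat_one_mod_four hp4, one_mul,
      jacobiSym.quadratic_reciprocity_one_mod_four' hbodd hp4]
    have : jacobiSym (p:ℤ) (4 * v + 1) = jacobiSym (-1) (4 * v + 1) := by
      apply jacobiSym.mod_left'
      apply Int.emod_emod_of_dvd _ (dvd_refl _) |>.symm.trans ?_
      rw [Int.emod_emod_of_dvd _ (dvd_refl _)]
      apply Int.ModEq.symm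
      rw [Int.modEq_iff_dvd]
      exact ⟨m, by rw [sub_neg_eq_add]; exact_mod_cast hpv⟩
    rw [this, jacobiSym.at_neg_one hbodd, ZMod.χ₄_nat_one_mod_four (by omega)]
  obtain ⟨r, hr⟩ := exists_sq_dvd p _ hp hJ
  refine three_sq_of_residue m ((4 * v + 1 : ℕ):ℤ) p r ?_ (by exact_mod_cast hp.pos)
    (by positivity) hr
  have : (p:ℤ) + 1 = ((4 * v + 1 : ℕ) : ℤ) * m := by exact_mod_cast hpv
  linarith

lemma three_sq_odd (m : ℕ) (hm : m % 8 = 1 ∨ m % 8 = 3 ∨ m % 8 = 5) :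
    ∃ x y z : ℤ, (m : ℤ) = x ^ 2 + y ^ 2 + z ^ 2 := by
  obtain ⟨c, hc⟩ : ∃ c, (c = 1 ∧ m % 8 = 3) ∨ (c = 3 ∧ (m % 8 = 1 ∨ m % 8 = 5)) := by
    rcases hm with h | h | h
    · exact ⟨3, by omega⟩
    · exact ⟨1, by omega⟩
    · exact ⟨3, by omega⟩
  obtain ⟨t, ht⟩ : ∃ t, 2 * t + 1 = c * m := by
    rcases hc with ⟨rfl, h⟩ | ⟨rfl, h⟩
    · exact ⟨(m - 1) / 2, by omega⟩
    · exact ⟨(3 * m - 1) / 2, by omega⟩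
  have ht4 : t % 4 = if m % 8 = 5 then 3 else 1 := by
    rcases hc with ⟨rfl, h⟩ | ⟨rfl, h⟩ <;> split_ifs <;> omega
  have hcop : t.Coprime (4 * m) := by
    apply Nat.Coprime.mul_right
    · have : Nat.Coprime t 2 := by
        rw [Nat.coprime_two_right, Nat.odd_iff]; split_ifs at ht4 <;> omega
      exact Nat.Coprime.mul_right this this
    · have h2 : Nat.Coprime t (c * m) := by rw [← ht]; simp
      exact h2.coprime_mul_left_right
  obtain ⟨p, hgt, hp, hmod⟩ := Nat.forall_exists_prime_gt_and_modEq t (by omega) hcop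
  obtain ⟨v, hv⟩ := (Nat.modEq_iff_dvd' (show t ≤ p by omega)).1 hmod.symm
  obtain ⟨b, hb⟩ : ∃ b, b = 8 * v + c := ⟨_, rfl⟩
  have hpt : p = t + 4 * m * v := by omega
  have hpv : 2 * p + 1 = b * m := by
    rw [hb, hpt]; linarith
  have hp4 : p % 4 = if m % 8 = 5 then 3 else 1 := by
    rw [← ht4, hpt, mul_assoc]; omega
  have hbodd : Odd b := by rw [Nat.odd_iff]; omega
  have hpodd : Odd p := by rw [Nat.odd_iff]; split_ifs at hp4 <;> omega
  have h2p : jacobiSym 2 b * jacobiSym (p:ℤ) b = jacobiSym (-1) b := by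
    rw [← jacobiSym.mul_left]
    apply jacobiSym.mod_left'
    apply Int.ModEq.symm
    rw [Int.modEq_iff_dvd]
    exact ⟨m, by rw [sub_neg_eq_add]; exact_mod_cast hpv⟩
  rw [jacobiSym.at_two hbodd, jacobiSym.at_neg_one hbodd] at h2p
  have hJp : jacobiSym (p:ℤ) b = 1 := by
    rcases hc with ⟨hc, h⟩ | ⟨hc, h⟩
    · have hb8 : b % 8 = 1 := by omega
      rw [ZMod.χ₈_nat_eq_if_mod_eight, ZMod.χ₄_nat_one_mod_four (by omega)] at h2p
      simpa [hb8, show b % 2 = 1 by omega] using h2p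
    · have hb8 : b % 8 = 3 := by omega
      rw [ZMod.χ₈_nat_eq_if_mod_eight, ZMod.χ₄_nat_three_mod_four (by omega)] at h2p
      simpa [hb8, show b % 2 = 1 by omega] using h2p
  have hJ : jacobiSym (-(b:ℤ)) p = 1 := by
    rw [jacobiSym.neg _ hpodd]
    split_ifs at hp4 with h5
    · rw [ZMod.χ₄_nat_three_mod_four hp4,
        jacobiSym.quadratic_reciprocity_three_mod_four (by omega) hp4, hJp]; norm_num
    · rw [ZMod.χ₄_nat_one_mod_four hp4,
        jacobiSym.quadratic_reciprocity_one_mod_four' hbodd hp4, hJp]; norm_num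
  obtain ⟨r0, hr0⟩ := exists_sq_dvd p _ hp hJ
  obtain ⟨r, hr, hrodd⟩ : ∃ r : ℤ, (p:ℤ) ∣ r ^ 2 + b ∧ Odd r := by
    rcases Int.even_or_odd r0 with h | h
    · refine ⟨r0 + p, ?_, h.add_odd (by exact_mod_cast hpodd)⟩
      have : (r0 + p) ^ 2 + (b:ℤ) = (r0 ^ 2 + b) + p * (2 * r0 + p) := by ring
      rw [this]
      exact dvd_add hr0 (dvd_mul_right _ _)
    · exact ⟨r0, hr0, h⟩
  have h2 : (2:ℤ) ∣ r ^ 2 + b := by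
    apply Even.two_dvd
    exact hrodd.pow.add_odd (by exact_mod_cast hbodd)
  have hdvd : (2 * p : ℤ) ∣ r ^ 2 + b := by
    apply IsCoprime.mul_dvd _ h2 hr
    have : Nat.Coprime 2 p := by rwa [Nat.coprime_two_left]
    exact_mod_cast this.isCoprime
  refine three_sq_of_residue m b (2 * p) r ?_ (by have := hp.pos; positivity)
    (by exact_mod_cast hbodd.pos) hdvd
  have : 2 * (p:ℤ) + 1 = b * m := by exact_mod_cast hpv
  linarith

lemma hex_cast (x : ℕ) : ((x * (2 * x - 1) : ℕ) : ℤ) = 2 * (x:ℤ) ^ 2 - x := by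
  rcases Nat.eq_zero_or_pos x with rfl | h
  · simp
  · push_cast [show 1 ≤ 2 * x by omega]; ring

def IsSumHex (n : ℕ) : Prop := ∃ x₁ x₂ x₃ x₄ : ℕ,
  n = x₁ * (2 * x₁ - 1) + x₂ * (2 * x₂ - 1) + x₃ * (2 * x₃ - 1) + x₄ * (2 * x₄ - 1)

lemma isSumHex_of (n : ℕ) (b x y z : ℤ) (hb : 0 ≤ b)
    (hD : x ^ 2 + y ^ 2 + z ^ 2 = 2 * n + 2 * b - b ^ 2)
    (hlt : 6 * (n:ℤ) < 4 * b ^ 2 + 2 * b + 16)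
    (h4 : (4:ℤ) ∣ b + x + y + z) (hxy : (2:ℤ) ∣ x + y) (hyz : (2:ℤ) ∣ y + z) : IsSumHex n := by
  obtain ⟨s, hs⟩ := h4
  obtain ⟨t, ht⟩ := hxy
  obtain ⟨w, hw⟩ := hyz
  have bound : ∀ q a c d : ℤ, 4 * q = b + a + c + d → a ^ 2 + c ^ 2 + d ^ 2 = x ^ 2 + y ^ 2 + z ^ 2 →
      0 ≤ q := by
    intro q a c d hq hsq
    by_contra hneg
    have h1 : b + 4 ≤ -(a + c + d) := by omega
    have h2 : (b + 4) ^ 2 ≤ (a + c + d) ^ 2 := by nlinarith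
    nlinarith [sq_nonneg (a - c), sq_nonneg (c - d), sq_nonneg (a - d)]
  have e1 := bound s x y z (by linarith) rfl
  have e2 := bound (s - w) x (-y) (-z) (by linarith) (by ring)
  have e3 := bound (s - w - t + y) (-x) y (-z) (by linarith) (by ring)
  have e4 := bound (s - t) (-x) (-y) z (by linarith) (by ring)
  refine ⟨s.toNat, (s - w).toNat, (s - w - t + y).toNat, (s - t).toNat, ?_⟩
  apply Int.ofNat.inj
  change (n : ℤ) = ((_ : ℕ) : ℤ)
  rw [Nat.cast_add, Nat.cast_add, Nat.cast_add, hex_cast, hex_cast, hex_cast, hex_cast,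
    Int.toNat_of_nonneg e1, Int.toNat_of_nonneg e2, Int.toNat_of_nonneg e3, Int.toNat_of_nonneg e4]
  have hz : z = 2 * w - y := by linarith
  have hx : x = 2 * t - y := by linarith
  have hb' : b = 4 * s - 2 * t - 2 * w + y := by linarith
  subst hz hx hb'
  linarith

lemma exists_residue (M : ℤ) (B r : ℤ) (hM : 0 < M) : ∃ b, b ≤ B ∧ B < b + M ∧ M ∣ b - r := by
  refine ⟨B - (B - r) % M, ?_, ?_, ?_⟩
  · linarith [Int.emod_nonneg (B - r) hM.ne']
  · linarith [Int.emod_lt_of_pos (B - r) hM]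
  · rw [show B - (B - r) % M - r = (B - r) - (B - r) % M by ring]
    exact Int.dvd_self_sub_emod

lemma exists_b (n : ℕ) (hn : 1300 ≤ n) (r : ℤ) : ∃ b : ℤ, 0 ≤ b ∧ 8 ∣ b - r ∧
    (b - 1) ^ 2 ≤ 2 * n + 1 ∧ 6 * (n:ℤ) < 4 * b ^ 2 + 2 * b + 16 := by
  obtain ⟨s, hs⟩ : ∃ s, s = Nat.sqrt (2 * n + 1) := ⟨_, rfl⟩
  have h1 : s * s ≤ 2 * n + 1 := by rw [hs]; exact Nat.sqrt_le _
  have h2 : 2 * n + 1 < (s + 1) * (s + 1) := by rw [hs]; exact Nat.lt_succ_sqrt _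
  have h3 : 51 ≤ s := by by_contra h; nlinarith [show s ≤ 50 by omega]
  obtain ⟨b, hb1, hb2, hb3⟩ := exists_residue 8 ((s:ℤ) + 1) r (by norm_num)
  zify at h1 h2 h3
  have hb : 45 ≤ b := by omega
  refine ⟨b, by omega, hb3, by nlinarith, ?_⟩
  have : ((s:ℤ) + 1) * (s + 1) ≤ (b + 7) * (b + 7) := by
    apply mul_self_le_mul_self <;> omega
  nlinarith

lemma sq_mod (x : ℤ) : (x % 2 = 1 ∧ x ^ 2 % 8 = 1) ∨ (x % 4 = 0 ∧ x ^ 2 % 8 = 0)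
    ∨ (x % 4 = 2 ∧ x ^ 2 % 8 = 4) := by
  have h : x % 8 = 0 ∨ x % 8 = 1 ∨ x % 8 = 2 ∨ x % 8 = 3 ∨ x % 8 = 4 ∨ x % 8 = 5 ∨ x % 8 = 6
    ∨ x % 8 = 7 := by omega
  rcases h with h | h | h | h | h | h | h | h <;> rw [sq, Int.mul_emod, h] <;> omega

lemma large_odd (n : ℕ) (hn : 1300 ≤ n) (ho : n % 2 = 1) : IsSumHex n := by
  obtain ⟨b, hb0, hb8, hb1, hb2⟩ := exists_b n hn (2 - n)
  have hbs := sq_mod b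
  obtain ⟨m, hm⟩ : ∃ m : ℕ, (m : ℤ) = 2 * n + 2 * b - b ^ 2 :=
    ⟨(2 * n + 2 * b - b ^ 2).toNat, Int.toNat_of_nonneg (by nlinarith)⟩
  obtain ⟨x, y, z, h⟩ := three_sq_odd m (by omega)
  have hx := sq_mod x
  have hy := sq_mod y
  have hz := sq_mod z
  have hx2 : x % 2 = 1 ∧ y % 2 = 1 ∧ z % 2 = 1 := by omega
  by_cases h4 : (4:ℤ) ∣ b + x + y + z
  · exact isSumHex_of n b x y z hb0 (by linarith) hb2 h4 (by omega) (by omega)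
  · exact isSumHex_of n b x y (-z) hb0 (by rw [neg_sq]; linarith) hb2 (by omega) (by omega)
      (by omega)

lemma large_even (n : ℕ) (hn : 1300 ≤ n) (ho : n % 2 = 0) : IsSumHex n := by
  obtain ⟨b, hb0, hb8, hb1, hb2⟩ := exists_b n hn (4 - n)
  obtain ⟨c, rfl⟩ : ∃ c, b = 2 * c := ⟨b / 2, by omega⟩
  obtain ⟨k, hk⟩ : ∃ k : ℕ, n = 2 * k := ⟨n / 2, by omega⟩
  have hcs := sq_mod c
  have hnn : 0 ≤ k + c - c ^ 2 := by
    have : (n : ℤ) = 2 * k := by exact_mod_cast hk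
    nlinarith
  obtain ⟨m, hm⟩ : ∃ m : ℕ, (m : ℤ) = k + c - c ^ 2 :=
    ⟨(k + c - c ^ 2).toNat, Int.toNat_of_nonneg hnn⟩
  have h3 : ∃ x y z : ℤ, (m : ℤ) = x ^ 2 + y ^ 2 + z ^ 2 := by
    by_cases hm2 : m % 4 = 2
    · exact three_sq_even m hm2
    · exact three_sq_odd m (by omega)
  obtain ⟨x, y, z, h⟩ := h3
  have hx := sq_mod x
  have hy := sq_mod y
  have hz := sq_mod z
  have hD : (2 * x) ^ 2 + (2 * y) ^ 2 + (2 * z) ^ 2 = 2 * (n:ℤ) + 2 * (2 * c) - (2 * c) ^ 2 := by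
    have : (n : ℤ) = 2 * k := by exact_mod_cast hk
    rw [this]; linarith
  exact isSumHex_of n (2 * c) (2 * x) (2 * y) (2 * z) hb0 hD hb2 (by omega) (by omega) (by omega)

/-- Bit masks of the sums of one, two, three hexagonal numbers below 1300. -/
def maskA : ℕ := 577756298062692634882899796324160980604864712805982506479690095545235739711750281141911760533258003215166910996122610009234281460940311896632995024671026519984319803918615291811470489005009182588049745986323756835435392328684237554635398108465776780625360379986995830994326902437712880971194703881757938922969613793355192630838731545060401722852559168564737281294893123
def maskB : ℕ := 1406862374200814128740463432184647113846163819354412470883629878954004703579022766949838842924747981231104864887553617667983347972878803806091942600561169502448537387872480952178608235433954346381551624235134090823703263723556983608821663832679991546164497152429399736828016153699755783672972866687722921495754640727305567317458072216719879355145616849709417303677520433170502780199295357127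
def maskC : ℕ := 21826848792874456325465684348636694330048750520441753072212587887972891130518441551039021656593374066646709794423887563334934185074856869429135847324136899050494271279731402714219142748671722595913251989264477741283540709395265876958618524510341885403221743853042102001915837257568916556539185919428108635964536446107425266128269765731919771052495216723015424764976509320133134629340963123663

def hexN (x : ℕ) : ℕ := x * (2 * x - 1)

/-- `k` minus some hexagonal number is in the mask. -/
def chk (M k : ℕ) : Bool := (List.range 26).any fun a => (hexN a).ble k && M.testBit (k - hexN a)

lemma chk_spec {M k : ℕ} (h : chk M k = true) :
    ∃ a j, k = hexN a + j ∧ M.testBit j = true := by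
  simp only [chk, List.any_eq_true, Bool.and_eq_true, Nat.ble_eq] at h
  obtain ⟨a, -, h1, h2⟩ := h
  exact ⟨a, k - hexN a, by omega, h2⟩

lemma maskA_chk : ∀ k < 1300, maskA.testBit k = true → chk 1 k = true := by decide +kernel
lemma maskB_chk : ∀ k < 1300, maskB.testBit k = true → chk maskA k = true := by decide +kernel
lemma maskC_chk : ∀ k < 1300, maskC.testBit k = true → chk maskB k = true := by decide +kernel
lemma small_chk : ∀ k < 1300, k ∉ [5, 10, 11, 20, 25, 26, 38, 39, 54, 65, 70, 114, 130] →
    chk maskC k = true := by decide +kernel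

lemma small_case (n : ℕ) (hn : n < 1300)
    (h : n ∉ [5, 10, 11, 20, 25, 26, 38, 39, 54, 65, 70, 114, 130]) : IsSumHex n := by
  obtain ⟨a, j, hj, h1⟩ := chk_spec (small_chk n hn h)
  obtain ⟨b, k, hk, h2⟩ := chk_spec (maskC_chk j (by omega) h1)
  obtain ⟨c, l, hl, h3⟩ := chk_spec (maskB_chk k (by omega) h2)
  obtain ⟨d, i, hi, h4⟩ := chk_spec (maskA_chk l (by omega) h3)
  have hi0 : i = 0 := by
    by_contra hne
    have : (1:ℕ) < 2 ^ i := Nat.one_lt_two_pow hne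
    rw [Nat.testBit_lt_two_pow this] at h4
    exact Bool.false_ne_true h4
  refine ⟨a, b, c, d, ?_⟩
  simp only [hexN] at hj hk hl hi
  omega

lemma excluded : ∀ a : Fin 9, ∀ b : Fin 9, ∀ c : Fin 9, ∀ d : Fin 9,
    hexN a + hexN b + hexN c + hexN d ∉
      [5, 10, 11, 20, 25, 26, 38, 39, 54, 65, 70, 114, 130] := by decide +kernel

lemma hexN_lt {x : ℕ} (h : hexN x ≤ 130) : x < 9 := by
  by_contra hx
  have : 9 * 17 ≤ x * (2 * x - 1) := Nat.mul_le_mul (by omega) (by omega)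
  unfold hexN at h
  omega

theorem sum_four_hexagonal_range :
    {n : ℕ | ∃ x₁ x₂ x₃ x₄ : ℕ,
        n = x₁ * (2 * x₁ - 1) + x₂ * (2 * x₂ - 1) + x₃ * (2 * x₃ - 1) + x₄ * (2 * x₄ - 1)}
      = {n : ℕ | n ∉ ({5, 10, 11, 20, 25, 26, 38, 39, 54, 65, 70, 114, 130} : Set ℕ)} := by
  have hmem : ∀ n : ℕ, n ∈ ({5, 10, 11, 20, 25, 26, 38, 39, 54, 65, 70, 114, 130} : Set ℕ) ↔
      n ∈ [5, 10, 11, 20, 25, 26, 38, 39, 54, 65, 70, 114, 130] := by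
    intro n
    simp only [Set.mem_insert_iff, Set.mem_singleton_iff, List.mem_cons, List.not_mem_nil, or_false]
  ext n
  change IsSumHex n ↔ ¬ (n ∈ ({5, 10, 11, 20, 25, 26, 38, 39, 54, 65, 70, 114, 130} : Set ℕ))
  rw [hmem]
  constructor
  · rintro ⟨a, b, c, d, h⟩ hn
    change n = hexN a + hexN b + hexN c + hexN d at h
    have hle : n ≤ 130 := by
      simp only [List.mem_cons, List.not_mem_nil, or_false] at hn
      omega
    apply excluded ⟨a, hexN_lt (by omega)⟩ ⟨b, hexN_lt (by omega)⟩ ⟨c, hexN_lt (by omega)⟩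
      ⟨d, hexN_lt (by omega)⟩
    rw [h] at hn
    exact hn
  · intro hn
    by_cases hs : n < 1300
    · exact small_case n hs hn
    · rcases Nat.mod_two_eq_zero_or_one n with h | h
      · exact large_even n (by omega) h
      · exact large_odd n (by omega) h
end

section
/- The set of all sums p₁₀(x₁) + p₁₀(x₂) + p₁₀(x₃) + p₁₀(x₄) with x₁, x₂, x₃, x₄ integers equals the set of all nonnegative integers except 5, 6, 26. -/
/-- The Gram matrix of three integer vectors in `ℤ³`. -/
def IsGram (a b c p q r : ℤ) : Prop :=
  ∃ u₁ u₂ u₃ v₁ v₂ v₃ w₁ w₂ w₃ : ℤ,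
    u₁ * u₁ + u₂ * u₂ + u₃ * u₃ = a ∧ v₁ * v₁ + v₂ * v₂ + v₃ * v₃ = b ∧
    w₁ * w₁ + w₂ * w₂ + w₃ * w₃ = c ∧ u₁ * v₁ + u₂ * v₂ + u₃ * v₃ = p ∧
    u₁ * w₁ + u₂ * w₂ + u₃ * w₃ = q ∧ v₁ * w₁ + v₂ * w₂ + v₃ * w₃ = r

theorem IsGram.of_sl2 {a b c p q r α β γ δ : ℤ} (h : α * δ - β * γ = 1)
    (H : IsGram a (b * α ^ 2 + 2 * r * α * β + c * β ^ 2) (b * γ ^ 2 + 2 * r * γ * δ + c * δ ^ 2)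
      (α * p + β * q) (γ * p + δ * q) (b * α * γ + r * (α * δ + β * γ) + c * β * δ)) :
    IsGram a b c p q r := by
  obtain ⟨u₁, u₂, u₃, v₁, v₂, v₃, w₁, w₂, w₃, h1, h2, h3, h4, h5, h6⟩ := H
  refine ⟨u₁, u₂, u₃, δ * v₁ - β * w₁, δ * v₂ - β * w₂, δ * v₃ - β * w₃,
    -γ * v₁ + α * w₁, -γ * v₂ + α * w₂, -γ * v₃ + α * w₃, h1, ?_, ?_, ?_, ?_, ?_⟩
  · linear_combination δ ^ 2 * h2 - 2 * δ * β * h6 + β ^ 2 * h3 + b * (α * δ - β * γ + 1) * h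
  · linear_combination γ ^ 2 * h2 - 2 * γ * α * h6 + α ^ 2 * h3 + c * (α * δ - β * γ + 1) * h
  · linear_combination δ * h4 - β * h5 + p * h
  · linear_combination -γ * h4 + α * h5 + q * h
  · linear_combination -δ * γ * h2 + (δ * α + β * γ) * h6 - β * α * h3
      + r * (α * δ - β * γ + 1) * h

theorem IsGram.of_shear {a b c p q r : ℤ} (k : ℤ)
    (H : IsGram a (b + 2 * k * p + k ^ 2 * a) c (p + k * a) q (r + k * q)) :
    IsGram a b c p q r := by
  obtain ⟨u₁, u₂, u₃, v₁, v₂, v₃, w₁, w₂, w₃, h1, h2, h3, h4, h5, h6⟩ := H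
  refine ⟨u₁, u₂, u₃, v₁ - k * u₁, v₂ - k * u₂, v₃ - k * u₃, w₁, w₂, w₃, h1, ?_, h3, ?_, h5, ?_⟩
  · linear_combination h2 - 2 * k * h4 + k ^ 2 * h1
  · linear_combination h4 - k * h1
  · linear_combination h6 - k * h5

theorem IsGram.of_swap {a b c p q r : ℤ} (H : IsGram b a c p r q) : IsGram a b c p q r := by
  obtain ⟨u₁, u₂, u₃, v₁, v₂, v₃, w₁, w₂, w₃, h1, h2, h3, h4, h5, h6⟩ := H
  exact ⟨v₁, v₂, v₃, u₁, u₂, u₃, w₁, w₂, w₃, h2, h1, h3, by linarith, h6, h5⟩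

theorem exists_shift (a p : ℤ) (ha : 0 < a) : ∃ k : ℤ, 2 * (p + k * a) ≤ a ∧ -a ≤ 2 * (p + k * a) := by
  refine ⟨-((2 * p + a) / (2 * a)), ?_⟩
  have h1 := Int.emod_add_mul_ediv (2 * p + a) (2 * a)
  have h2 := Int.emod_nonneg (2 * p + a) (b := 2 * a) (by omega)
  have h3 := Int.emod_lt_of_pos (2 * p + a) (b := 2 * a) (by omega)
  constructor <;> nlinarith

theorem binary_reduction (N : ℕ) : ∀ A B C D : ℤ, A.toNat ≤ N → 0 < A → 0 < D →
    A * C - B ^ 2 = D → ∃ α β γ δ : ℤ, α * δ - β * γ = 1 ∧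
      0 < A * α ^ 2 + 2 * B * α * β + C * β ^ 2 ∧
      3 * (A * α ^ 2 + 2 * B * α * β + C * β ^ 2) ^ 2 ≤ 4 * D := by
  induction N with
  | zero => intro A B C D h1 h2; omega
  | succ N ih =>
    intro A B C D hN hA hD hdet
    obtain ⟨k, hk1, hk2⟩ := exists_shift A B hA
    set B' := B + k * A with hB'
    set C' := C + 2 * k * B + k ^ 2 * A with hC'
    have hdet' : A * C' - B' ^ 2 = D := by rw [hB', hC']; linear_combination hdet
    have hsq : 4 * B' ^ 2 ≤ A ^ 2 := by nlinarith
    by_cases hlt : C' < A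
    · have hC0 : 0 < C' := by
        by_contra hcon
        nlinarith [sq_nonneg B']
      obtain ⟨α, β, γ, δ, h1, h2, h3⟩ := ih C' (-B') A D (by omega) hC0 hD
        (by linear_combination hdet')
      have key : A * (α * k - β) ^ 2 + 2 * B * (α * k - β) * α + C * α ^ 2
          = C' * α ^ 2 + 2 * (-B') * α * β + A * β ^ 2 := by rw [hB', hC']; ring
      refine ⟨α * k - β, α, γ * k - δ, γ, by linear_combination h1, ?_, ?_⟩
      · rw [key]; exact h2
      · rw [key]; exact h3
    · refine ⟨1, 0, 0, 1, by ring, by linarith, ?_⟩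
      have : A * A ≤ A * C' := by nlinarith
      nlinarith

theorem ternary_reduction (N : ℕ) : ∀ a b c p q r : ℤ, a.toNat ≤ N → 0 < a → 0 < a * b - p ^ 2 →
    a * b * c + 2 * p * q * r - a * r ^ 2 - b * q ^ 2 - c * p ^ 2 = 1 → IsGram a b c p q r := by
  induction N with
  | zero => intro a b c p q r h1 h2; omega
  | succ N ih =>
    intro a b c p q r hN ha hA hdet
    obtain ⟨α, β, γ, δ, h1, h2, h3⟩ := binary_reduction _ (a * b - p ^ 2) (a * r - p * q)
      (a * c - q ^ 2) a le_rfl hA ha (by linear_combination a * hdet)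
    apply IsGram.of_sl2 h1
    have hdet' : a * (b * α ^ 2 + 2 * r * α * β + c * β ^ 2) *
          (b * γ ^ 2 + 2 * r * γ * δ + c * δ ^ 2) + 2 * (α * p + β * q) * (γ * p + δ * q) *
          (b * α * γ + r * (α * δ + β * γ) + c * β * δ)
        - a * (b * α * γ + r * (α * δ + β * γ) + c * β * δ) ^ 2
        - (b * α ^ 2 + 2 * r * α * β + c * β ^ 2) * (γ * p + δ * q) ^ 2
        - (b * γ ^ 2 + 2 * r * γ * δ + c * δ ^ 2) * (α * p + β * q) ^ 2 = 1 := by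
      linear_combination (α * δ - β * γ) ^ 2 * hdet + (α * δ - β * γ + 1) * h1
    have hA' : (a * b - p ^ 2) * α ^ 2 + 2 * (a * r - p * q) * α * β + (a * c - q ^ 2) * β ^ 2
        = a * (b * α ^ 2 + 2 * r * α * β + c * β ^ 2) - (α * p + β * q) ^ 2 := by ring
    rw [hA'] at h2 h3
    generalize b * α ^ 2 + 2 * r * α * β + c * β ^ 2 = b' at *
    generalize b * γ ^ 2 + 2 * r * γ * δ + c * δ ^ 2 = c' at *
    generalize α * p + β * q = p' at *
    generalize γ * p + δ * q = q' at *
    generalize b * α * γ + r * (α * δ + β * γ) + c * β * δ = r' at *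
    clear hA' hdet h1 hA
    obtain ⟨k, hk1, hk2⟩ := exists_shift a p' ha
    apply IsGram.of_shear k
    have e1 : a * (b' + 2 * k * p' + k ^ 2 * a) - (p' + k * a) ^ 2 = a * b' - p' ^ 2 := by ring
    have e2 : a * (b' + 2 * k * p' + k ^ 2 * a) * c' + 2 * (p' + k * a) * q' * (r' + k * q')
        - a * (r' + k * q') ^ 2 - (b' + 2 * k * p' + k ^ 2 * a) * q' ^ 2
        - c' * (p' + k * a) ^ 2 = 1 := by linear_combination hdet'
    rw [← e1] at h2 h3
    generalize b' + 2 * k * p' + k ^ 2 * a = b at *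
    generalize p' + k * a = p at *
    generalize r' + k * q' = r at *
    clear e1 hdet'
    have hsq : 4 * p ^ 2 ≤ a ^ 2 := by nlinarith
    by_cases hlt : b < a
    · have hb : 0 < b := by
        by_contra hcon
        nlinarith [sq_nonneg p]
      apply IsGram.of_swap
      exact ih b a c' p r q' (by omega) hb (by linarith) (by linear_combination e2)
    · have h4 : a * a ≤ a * b := by nlinarith
      have h5 : 3 * a ^ 2 ≤ 4 * (a * b - p ^ 2) := by nlinarith
      have ha1 : a = 1 := by
        by_contra hne
        have ha2 : 2 ≤ a := by omega
        generalize a * b - p ^ 2 = t at *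
        have : 6 * a ≤ 4 * t := by nlinarith
        nlinarith
      subst ha1
      have hp : p = 0 := by omega
      subst hp
      have hb : b = 1 := by
        have : b < 2 := by nlinarith
        omega
      subst hb
      exact ⟨1, 0, 0, 0, 1, 0, q', r, 1, by ring, by ring, by linarith, by ring, by ring, by ring⟩

theorem three_sq_of_dvd (n d m x : ℤ) (hd : 0 < d) (hm : 0 < m) (hmn : m = d * n - 1)
    (hx : m ∣ x ^ 2 + d) : ∃ u v w : ℤ, n = u ^ 2 + v ^ 2 + w ^ 2 := by
  obtain ⟨t, ht⟩ := hx
  obtain ⟨u₁, u₂, u₃, v₁, v₂, v₃, w₁, w₂, w₃, h1, h2, h3, h4, h5, h6⟩ :=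
    ternary_reduction _ m t n x 0 1 le_rfl hm (by linarith)
      (by linear_combination (-n) * ht - hmn)
  exact ⟨w₁, w₂, w₃, by linarith⟩

open NumberTheorySymbols in
theorem dvd_of_jacobi {p : ℕ} (hp : p.Prime) {a : ℤ} (h : J(a | p) = 1) :
    ∃ x : ℤ, (p : ℤ) ∣ x ^ 2 - a := by
  have : Fact p.Prime := ⟨hp⟩
  obtain ⟨y, hy⟩ := ZMod.isSquare_of_jacobiSym_eq_one h
  refine ⟨y.val, ?_⟩
  rw [← ZMod.intCast_zmod_eq_zero_iff_dvd]
  push_cast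
  rw [hy, ZMod.natCast_val, ZMod.cast_id]
  ring

open NumberTheorySymbols ZMod in
theorem three_sq_two_mod_four (n : ℕ) (hn : n % 4 = 2) :
    ∃ u v w : ℤ, (n : ℤ) = u ^ 2 + v ^ 2 + w ^ 2 := by
  have hcop : (n - 1).Coprime (4 * n) := by
    apply Nat.Coprime.mul_right
    · have : Nat.Coprime (n - 1) 2 := by
        rw [Nat.coprime_two_right, Nat.odd_iff]; omega
      simpa using this.pow_right 2
    · obtain ⟨k, rfl⟩ : ∃ k, n = k + 1 := ⟨n - 1, by omega⟩
      simp
  obtain ⟨p, hgt, hp, hmod⟩ :=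
    Nat.forall_exists_prime_gt_and_modEq (4 * n) (by omega : 4 * n ≠ 0) hcop
  obtain ⟨j, hj⟩ := (Nat.modEq_iff_dvd' (by omega)).1 hmod.symm
  have hpe : p + 1 = (4 * j + 1) * n := by
    have : p = 4 * n * j + (n - 1) := by omega
    have h2 : 1 ≤ n := by omega
    zify [h2] at this ⊢
    rw [this]; ring
  have hp4 : p % 4 = 1 := by
    have : p = 4 * (n * j) + (n - 1) := by rw [← mul_assoc]; omega
    omega
  have hpodd : Odd p := Nat.odd_iff.2 (by omega)
  have hdodd : Odd (4 * j + 1) := Nat.odd_iff.2 (by omega)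
  have hJ : J(-((4 * j + 1 : ℕ) : ℤ) | p) = 1 := by
    rw [jacobiSym.neg _ hpodd, χ₄_nat_one_mod_four hp4, one_mul,
      jacobiSym.quadratic_reciprocity_one_mod_four (by omega) hpodd]
    have : J((p : ℤ) | 4 * j + 1) = J(-1 | 4 * j + 1) := by
      apply jacobiSym.mod_left'
      apply Int.ModEq.symm
      apply (Int.modEq_iff_dvd).2
      refine ⟨n, ?_⟩
      have : (p : ℤ) + 1 = (4 * j + 1) * n := by exact_mod_cast hpe
      push_cast; linarith
    rw [this, jacobiSym.at_neg_one hdodd, χ₄_nat_one_mod_four (by omega)]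
  obtain ⟨x, hx⟩ := dvd_of_jacobi hp hJ
  refine three_sq_of_dvd n (4 * j + 1) p x (by positivity) (by exact_mod_cast hp.pos) ?_ ?_
  · have : (p : ℤ) + 1 = (4 * j + 1) * n := by exact_mod_cast hpe
    linarith
  · push_cast at hx
    rwa [sub_neg_eq_add] at hx

open NumberTheorySymbols ZMod in
theorem three_sq_odd_aux (n c : ℕ) (hc : c % 8 = 1 ∨ c % 8 = 3) (hodd : c * n % 4 = 3)
    (h4 : c % 8 = 3 ∨ c * n % 8 = 3) :
    ∃ u v w : ℤ, (n : ℤ) = u ^ 2 + v ^ 2 + w ^ 2 := by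
  obtain ⟨a, ha⟩ : ∃ a, c * n = 2 * a + 1 := ⟨c * n / 2, by omega⟩
  have hn0 : n ≠ 0 := by rintro rfl; simp at hodd
  have hcop : a.Coprime (4 * n) := by
    apply Nat.Coprime.mul_right
    · have : Nat.Coprime a 2 := by
        rw [Nat.coprime_two_right, Nat.odd_iff]; omega
      simpa using this.pow_right 2
    · rw [← Nat.isCoprime_iff_coprime]
      refine ⟨-2, c, ?_⟩
      have : (c : ℤ) * n = 2 * a + 1 := by exact_mod_cast ha
      linarith
  obtain ⟨p, hgt, hp, hmod⟩ :=
    Nat.forall_exists_prime_gt_and_modEq a (by omega : 4 * n ≠ 0) hcop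
  obtain ⟨j, hj⟩ := (Nat.modEq_iff_dvd' (by omega)).1 hmod.symm
  obtain ⟨d, hd⟩ : ∃ d, d = 8 * j + c := ⟨_, rfl⟩
  have hpa : p = 4 * (n * j) + a := by rw [← mul_assoc]; omega
  have hpe : (2 * p + 1 : ℤ) = d * n := by
    have : (c : ℤ) * n = 2 * a + 1 := by exact_mod_cast ha
    rw [hpa, hd]; push_cast; linarith
  have hpodd : Odd p := Nat.odd_iff.2 (by omega)
  have hdodd : Odd d := Nat.odd_iff.2 (by omega)
  have h2 : J(-2 | d) = 1 := by
    rw [jacobiSym.at_neg_two hdodd, χ₈'_nat_eq_if_mod_eight]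
    have : d % 2 = 1 := by omega
    have : d % 8 = 1 ∨ d % 8 = 3 := by omega
    grind
  have hpd : J((p : ℤ) | d) = 1 := by
    have h3 : J(-2 * (p : ℤ) | d) = J(1 | d) := by
      apply jacobiSym.mod_left'
      apply Int.ModEq.symm
      apply (Int.modEq_iff_dvd).2
      exact ⟨-n, by linarith⟩
    rw [jacobiSym.mul_left, h2, one_mul, jacobiSym.one_left] at h3
    exact h3
  have hJ : J(-(d : ℤ) | p) = 1 := by
    rw [jacobiSym.neg _ hpodd]
    by_cases hp4 : p % 4 = 1
    · rw [χ₄_nat_one_mod_four hp4, one_mul,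
        ← jacobiSym.quadratic_reciprocity_one_mod_four hp4 hdodd, hpd]
    · have hp3 : p % 4 = 3 := by have := Nat.odd_iff.1 hpodd; omega
      rw [χ₄_nat_three_mod_four hp3,
        jacobiSym.quadratic_reciprocity_three_mod_four (by omega) hp3, hpd]
      norm_num
  obtain ⟨x, hx⟩ := dvd_of_jacobi hp hJ
  rw [sub_neg_eq_add] at hx
  have hd0 : (0 : ℤ) < d := by have := hdodd.pos; exact_mod_cast this
  have hp0 : (0 : ℤ) < p := by exact_mod_cast hp.pos
  have key : ∀ y : ℤ, Odd y → (p : ℤ) ∣ y ^ 2 + d → ∃ u v w : ℤ, (n : ℤ) = u ^ 2 + v ^ 2 + w ^ 2 := by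
    intro y hy hdv
    refine three_sq_of_dvd n d (2 * p) y hd0 (by linarith) (by linarith) ?_
    apply IsCoprime.mul_dvd
    · rw [Int.isCoprime_iff_gcd_eq_one]
      have := Nat.coprime_two_left.2 hpodd
      exact_mod_cast this
    · have : Odd (d : ℤ) := by exact_mod_cast hdodd
      exact (hy.pow.add_odd this).two_dvd
    · exact hdv
  rcases Int.even_or_odd x with he | ho
  · apply key (x + p) (he.add_odd (by exact_mod_cast hpodd))
    have : (x + p) ^ 2 + d = (x ^ 2 + d) + p * (2 * x + p) := by ring
    rw [this]
    exact dvd_add hx (dvd_mul_right _ _)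
  · exact key x ho hx

theorem three_sq (n : ℤ) (h0 : 0 ≤ n) (h : n % 4 = 2 ∨ n % 4 = 1 ∨ n % 8 = 3) :
    ∃ u v w : ℤ, n = u ^ 2 + v ^ 2 + w ^ 2 := by
  lift n to ℕ using h0
  rcases h with h | h | h
  · exact three_sq_two_mod_four n (by omega)
  · exact three_sq_odd_aux n 3 (by omega) (by omega) (by omega)
  · exact three_sq_odd_aux n 1 (by omega) (by omega) (by omega)

/-- `n` is a sum of four generalized decagonal numbers. -/
def IsSumDec (n : ℤ) : Prop := ∃ x₁ x₂ x₃ x₄ : ℤ,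
  n = (4 * x₁ ^ 2 - 3 * x₁) + (4 * x₂ ^ 2 - 3 * x₂) + (4 * x₃ ^ 2 - 3 * x₃) + (4 * x₄ ^ 2 - 3 * x₄)

theorem odd_of_three_sq {u v w : ℤ} (h : (u ^ 2 + v ^ 2 + w ^ 2) % 8 = 3) :
    u % 2 = 1 ∧ v % 2 = 1 ∧ w % 2 = 1 := by
  have key : ∀ t : ℤ, (t % 2 = 1 ∧ t ^ 2 % 8 = 1) ∨ (t % 2 = 0 ∧ (t ^ 2 % 8 = 0 ∨ t ^ 2 % 8 = 4)) := by
    intro t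
    have : t % 8 = 0 ∨ t % 8 = 1 ∨ t % 8 = 2 ∨ t % 8 = 3 ∨ t % 8 = 4 ∨ t % 8 = 5 ∨ t % 8 = 6 ∨
      t % 8 = 7 := by omega
    rcases this with h | h | h | h | h | h | h | h <;> simp [pow_two, Int.mul_emod, h] <;> omega
  have := key u
  have := key v
  have := key w
  omega

theorem sumDec_odd (n : ℤ) (h10 : 10 ≤ n) (hn : n % 2 = 1) : IsSumDec n := by
  obtain ⟨b, hb1, hb2, hb3⟩ : ∃ b : ℤ, -2 ≤ b ∧ b ≤ 5 ∧ (n + 3 * b) % 8 = 4 :=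
    ⟨(6 - 3 * n) % 8 - 2, by omega, by omega, by omega⟩
  have hN : 0 ≤ n + 3 * b - b ^ 2 ∧ (n + 3 * b - b ^ 2) % 8 = 3 := by
    interval_cases b <;> omega
  obtain ⟨u, v, w, huvw⟩ := three_sq _ hN.1 (Or.inr (Or.inr hN.2))
  obtain ⟨hu, hv, hw⟩ := odd_of_three_sq (huvw ▸ hN.2)
  have hb : b % 2 = 1 := by omega
  have main : ∀ u : ℤ, n + 3 * b - b ^ 2 = u ^ 2 + v ^ 2 + w ^ 2 → u % 2 = 1 →
      (b + u + v + w) % 4 = 0 → IsSumDec n := by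
    intro u huvw hu hs
    obtain ⟨x₁, h1⟩ : (4 : ℤ) ∣ b + u + v + w := by omega
    obtain ⟨x₂, h2⟩ : (4 : ℤ) ∣ b + u - v - w := by omega
    obtain ⟨x₃, h3⟩ : (4 : ℤ) ∣ b - u + v - w := by omega
    obtain ⟨x₄, h4⟩ : (4 : ℤ) ∣ b - u - v + w := by omega
    refine ⟨x₁, x₂, x₃, x₄, ?_⟩
    have : 4 * n = 4 * ((4 * x₁ ^ 2 - 3 * x₁) + (4 * x₂ ^ 2 - 3 * x₂) + (4 * x₃ ^ 2 - 3 * x₃)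
        + (4 * x₄ ^ 2 - 3 * x₄)) := by
      linear_combination 4 * huvw + (4 * x₁ + (b + u + v + w) - 3) * h1
        + (4 * x₂ + (b + u - v - w) - 3) * h2 + (4 * x₃ + (b - u + v - w) - 3) * h3
        + (4 * x₄ + (b - u - v + w) - 3) * h4
    linarith
  by_cases hs : (b + u + v + w) % 4 = 0
  · exact main u huvw hu hs
  · exact main (-u) (by linarith [neg_sq u]) (by omega) (by omega)

theorem sumDec_even (m : ℤ) (h27 : 27 ≤ m) : IsSumDec (2 * m) := by
  obtain ⟨c, s, hs, h0, hmod⟩ : ∃ c s : ℤ, m + 3 * c = 4 * s ∧ 0 ≤ 2 * s - c ^ 2 ∧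
      ((2 * s - c ^ 2) % 4 = 2 ∨ (2 * s - c ^ 2) % 4 = 1 ∨ (2 * s - c ^ 2) % 8 = 3) := by
    have hm : m % 4 = 0 ∨ m % 4 = 1 ∨ m % 4 = 2 ∨ m % 4 = 3 := by omega
    have try2 : ∀ c : ℤ, (m + 3 * c) % 4 = 0 → 0 ≤ 2 * ((m + 3 * c) / 4) - c ^ 2 →
      ((2 * ((m + 3 * c) / 4) - c ^ 2) % 4 = 2 ∨ (2 * ((m + 3 * c) / 4) - c ^ 2) % 4 = 1 ∨
        (2 * ((m + 3 * c) / 4) - c ^ 2) % 8 = 3) → ∃ c s : ℤ, m + 3 * c = 4 * s ∧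
        0 ≤ 2 * s - c ^ 2 ∧ ((2 * s - c ^ 2) % 4 = 2 ∨ (2 * s - c ^ 2) % 4 = 1 ∨
          (2 * s - c ^ 2) % 8 = 3) := fun c h1 h2 h3 => ⟨c, (m + 3 * c) / 4, by omega, h2, h3⟩
    by_contra hcon
    have h1 : ∀ c : ℤ, ¬ ((m + 3 * c) % 4 = 0 ∧ 0 ≤ 2 * ((m + 3 * c) / 4) - c ^ 2 ∧
        ((2 * ((m + 3 * c) / 4) - c ^ 2) % 4 = 2 ∨ (2 * ((m + 3 * c) / 4) - c ^ 2) % 4 = 1 ∨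
          (2 * ((m + 3 * c) / 4) - c ^ 2) % 8 = 3)) :=
      fun c hc => hcon (try2 c hc.1 hc.2.1 hc.2.2)
    rcases hm with hm | hm | hm | hm
    · have a1 := h1 0
      have a2 := h1 4
      clear h1 try2 hcon
      omega
    · have a1 := h1 (-3)
      have a2 := h1 1
      clear h1 try2 hcon
      omega
    · have a1 := h1 (-2)
      have a2 := h1 2
      clear h1 try2 hcon
      omega
    · have a1 := h1 (-1)
      have a2 := h1 3
      clear h1 try2 hcon
      omega
  obtain ⟨u, v, w, huvw⟩ := three_sq _ h0 hmod
  have hpar : (c + u + v + w) % 2 = 0 := by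
    have e : (c + u + v + w) = 2 * s - (c * (c - 1) + u * (u - 1) + v * (v - 1) + w * (w - 1)) := by
      linear_combination -huvw
    have k : ∀ t : ℤ, t * (t - 1) % 2 = 0 := fun t => Int.emod_eq_zero_of_dvd
      (Int.even_mul_pred_self t).two_dvd
    have := k c
    have := k u
    have := k v
    have := k w
    omega
  obtain ⟨x₁, h1⟩ : (2 : ℤ) ∣ c + u + v + w := by omega
  obtain ⟨x₂, h2⟩ : (2 : ℤ) ∣ c + u - v - w := by omega
  obtain ⟨x₃, h3⟩ : (2 : ℤ) ∣ c - u + v - w := by omega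
  obtain ⟨x₄, h4⟩ : (2 : ℤ) ∣ c - u - v + w := by omega
  refine ⟨x₁, x₂, x₃, x₄, ?_⟩
  have : 2 * (2 * m) = 2 * ((4 * x₁ ^ 2 - 3 * x₁) + (4 * x₂ ^ 2 - 3 * x₂) + (4 * x₃ ^ 2 - 3 * x₃)
      + (4 * x₄ ^ 2 - 3 * x₄)) := by
    linear_combination 4 * hs + 8 * huvw + (2 * (2 * x₁ + (c + u + v + w)) - 3) * h1
        + (2 * (2 * x₂ + (c + u - v - w)) - 3) * h2 + (2 * (2 * x₃ + (c - u + v - w)) - 3) * h3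
        + (2 * (2 * x₄ + (c - u - v + w)) - 3) * h4
  linarith

theorem sumDec_small (n : ℤ) (h : n ∈ ([0, 1, 2, 3, 4, 7, 8, 9, 10, 12, 14, 16, 18, 20, 22, 24, 28, 30, 32, 34, 36, 38, 40, 42, 44, 46, 48, 50, 52] : List ℤ)) : IsSumDec n := by
  simp only [List.mem_cons, List.not_mem_nil, or_false] at h
  rcases h with rfl | rfl | rfl | rfl | rfl | rfl | rfl | rfl | rfl | rfl | rfl | rfl | rfl | rfl | rfl | rfl | rfl | rfl | rfl | rfl | rfl | rfl | rfl | rfl | rfl | rfl | rfl | rfl | rfl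
  · exact ⟨0, 0, 0, 0, by norm_num⟩
  · exact ⟨0, 0, 0, 1, by norm_num⟩
  · exact ⟨0, 0, 1, 1, by norm_num⟩
  · exact ⟨0, 1, 1, 1, by norm_num⟩
  · exact ⟨1, 1, 1, 1, by norm_num⟩
  · exact ⟨0, 0, 0, -1, by norm_num⟩
  · exact ⟨0, 0, 1, -1, by norm_num⟩
  · exact ⟨0, 1, 1, -1, by norm_num⟩
  · exact ⟨0, 0, 0, 2, by norm_num⟩
  · exact ⟨0, 1, 1, 2, by norm_num⟩
  · exact ⟨0, 0, -1, -1, by norm_num⟩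
  · exact ⟨1, 1, -1, -1, by norm_num⟩
  · exact ⟨0, 1, -1, 2, by norm_num⟩
  · exact ⟨0, 0, 2, 2, by norm_num⟩
  · exact ⟨0, 0, 0, -2, by norm_num⟩
  · exact ⟨0, 1, 1, -2, by norm_num⟩
  · exact ⟨0, 0, 1, 3, by norm_num⟩
  · exact ⟨0, 1, -1, -2, by norm_num⟩
  · exact ⟨0, 0, 2, -2, by norm_num⟩
  · exact ⟨0, 0, -1, 3, by norm_num⟩
  · exact ⟨0, -1, -1, -2, by norm_num⟩
  · exact ⟨0, 1, 2, 3, by norm_num⟩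
  · exact ⟨1, -1, 2, -2, by norm_num⟩
  · exact ⟨0, 2, 2, -2, by norm_num⟩
  · exact ⟨0, 0, -2, -2, by norm_num⟩
  · exact ⟨0, 0, 1, -3, by norm_num⟩
  · exact ⟨1, 1, 1, -3, by norm_num⟩
  · exact ⟨0, 1, -2, 3, by norm_num⟩
  · exact ⟨0, 0, 0, 4, by norm_num⟩

theorem dec_bound (x : ℤ) : 0 ≤ 4 * x ^ 2 - 3 * x := by
  rcases le_or_gt x 0 with h | h <;> nlinarith

theorem dec_small (x : ℤ) (h : 4 * x ^ 2 - 3 * x ≤ 26) :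
    4 * x ^ 2 - 3 * x ∈ ([0, 1, 7, 10, 22] : List ℤ) := by
  have h1 : -3 < x := by nlinarith
  have h2 : x < 3 := by nlinarith
  interval_cases x <;> simp

theorem sum_four_generalized_decagonal_range :
    {n : ℤ | ∃ x₁ x₂ x₃ x₄ : ℤ,
        n = (4 * x₁ ^ 2 - 3 * x₁) + (4 * x₂ ^ 2 - 3 * x₂) + (4 * x₃ ^ 2 - 3 * x₃)
            + (4 * x₄ ^ 2 - 3 * x₄)}
      = {n : ℤ | 0 ≤ n ∧ n ∉ ({5, 6, 26} : Set ℤ)} := by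
  ext n
  simp only [Set.mem_ofPred_eq, Set.mem_insert_iff, Set.mem_singleton_iff, not_or]
  constructor
  · rintro ⟨x₁, x₂, x₃, x₄, h⟩
    have b1 := dec_bound x₁
    have b2 := dec_bound x₂
    have b3 := dec_bound x₃
    have b4 := dec_bound x₄
    have s1 := dec_small x₁
    have s2 := dec_small x₂
    have s3 := dec_small x₃
    have s4 := dec_small x₄
    generalize 4 * x₁ ^ 2 - 3 * x₁ = y₁ at *
    generalize 4 * x₂ ^ 2 - 3 * x₂ = y₂ at *
    generalize 4 * x₃ ^ 2 - 3 * x₃ = y₃ at *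
    generalize 4 * x₄ ^ 2 - 3 * x₄ = y₄ at *
    refine ⟨by linarith, ?_⟩
    by_contra hcon
    have hn : n = 5 ∨ n = 6 ∨ n = 26 := by omega
    have t1 := s1 (by omega)
    have t2 := s2 (by omega)
    have t3 := s3 (by omega)
    have t4 := s4 (by omega)
    have key : ∀ y₁ ∈ ([0, 1, 7, 10, 22] : List ℤ), ∀ y₂ ∈ ([0, 1, 7, 10, 22] : List ℤ),
        ∀ y₃ ∈ ([0, 1, 7, 10, 22] : List ℤ), ∀ y₄ ∈ ([0, 1, 7, 10, 22] : List ℤ),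
        y₁ + y₂ + y₃ + y₄ ∉ ([5, 6, 26] : List ℤ) := by
      set_option maxRecDepth 100000 in decide
    apply key y₁ t1 y₂ t2 y₃ t3 y₄ t4
    rw [← h]
    simpa using hn
  · rintro ⟨h0, h5, h6, h26⟩
    change IsSumDec n
    rcases Int.emod_two_eq_zero_or_one n with he | ho
    · by_cases hb : 54 ≤ n
      · obtain ⟨m, rfl⟩ : (2 : ℤ) ∣ n := by omega
        exact sumDec_even m (by omega)
      · apply sumDec_small
        simp only [List.mem_cons, List.not_mem_nil, or_false]
        omega
    · by_cases hb : 10 ≤ n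
      · exact sumDec_odd n hb ho
      · apply sumDec_small
        simp only [List.mem_cons, List.not_mem_nil, or_false]
        omega
end

section
/- Let m ≥ 3 be an integer such that m is odd or m is divisible by 4. Then every integer N ≥ 1628m³ can be written as N = p_{m+2}(x₁) + p_{m+2}(x₂) + 2·p_{m+2}(x₃) + 2·p_{m+2}(x₄) for some nonnegative integers x₁, x₂, x₃, x₄. -/
/-- Polygonal number of order `m+2`: `p_{m+2}(n) = (m·n² − (m−2)·n)/2 = m·n(n−1)/2 + n`. -/
def polygonal (m n : ℕ) : ℕ := m * (n * (n - 1)) / 2 + n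

/-- A nearest-integer shift. -/
lemma near_shift (B A : ℤ) (hA : 0 < A) :
    ∃ k : ℤ, -A ≤ 2 * (B + k * A) ∧ 2 * (B + k * A) ≤ A := by
  refine ⟨-((2 * B + A) / (2 * A)), ?_⟩
  have h1 := Int.emod_add_mul_ediv (2 * B + A) (2 * A)
  have h2 := Int.emod_nonneg (2 * B + A) (show (2 * A) ≠ 0 by omega)
  have h3 := Int.emod_lt_of_pos (2 * B + A) (show 0 < 2 * A by omega)
  constructor <;> nlinarith

/-- A fully reduced ternary form of determinant one. -/
lemma tern_reduced (a b c d e f : ℤ) (ha : 0 < a) (hA : 0 < a * d - b ^ 2)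
    (hdet : a * d * f + 2 * b * c * e - a * e ^ 2 - d * c ^ 2 - f * b ^ 2 = 1)
    (hB1 : -(a * d - b ^ 2) ≤ 2 * (a * e - b * c)) (hB2 : 2 * (a * e - b * c) ≤ a * d - b ^ 2)
    (hC : a * d - b ^ 2 ≤ a * f - c ^ 2)
    (hb1 : -a ≤ 2 * b) (hb2 : 2 * b ≤ a) (hd : a ≤ d) (x y z : ℤ) :
    ∃ r s t : ℤ, a * x ^ 2 + d * y ^ 2 + f * z ^ 2 + 2 * b * x * y + 2 * c * x * z
      + 2 * e * y * z = r ^ 2 + s ^ 2 + t ^ 2 := by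
  have hrel : (a * d - b ^ 2) * (a * f - c ^ 2) - (a * e - b * c) ^ 2 = a := by
    linear_combination a * hdet
  have key1 : 3 * (a * d - b ^ 2) ^ 2 ≤ 4 * a := by
    generalize a * d - b ^ 2 = A at *
    generalize a * f - c ^ 2 = C at *
    generalize a * e - b * c = B at *
    nlinarith [mul_nonneg (show 0 ≤ A - 2 * B by linarith) (show 0 ≤ A + 2 * B by linarith),
      mul_le_mul_of_nonneg_left hC hA.le]
  have key2 : 3 * a ^ 2 ≤ 4 * (a * d - b ^ 2) := by
    nlinarith [mul_nonneg (show 0 ≤ a - 2 * b by linarith) (show 0 ≤ a + 2 * b by linarith),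
      mul_le_mul_of_nonneg_left hd ha.le]
  have ha1 : a = 1 := by
    by_contra hne
    have h2 : 2 ≤ a := by omega
    generalize a * d - b ^ 2 = A at *
    have hAa : A ≤ a := by nlinarith
    nlinarith
  subst ha1
  have hb : b = 0 := by omega
  subst hb
  have hd1 : d = 1 := by nlinarith
  subst hd1
  refine ⟨x + c * z, y + e * z, z, ?_⟩
  linear_combination z ^ 2 * hdet

lemma tern : ∀ (k l : ℕ) (a b c d e f : ℤ), a.toNat = k → (a * d - b ^ 2).toNat = l →
    0 < a → 0 < a * d - b ^ 2 →
    a * d * f + 2 * b * c * e - a * e ^ 2 - d * c ^ 2 - f * b ^ 2 = 1 →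
    ∀ x y z : ℤ, ∃ r s t : ℤ, a * x ^ 2 + d * y ^ 2 + f * z ^ 2 + 2 * b * x * y + 2 * c * x * z
      + 2 * e * y * z = r ^ 2 + s ^ 2 + t ^ 2 := by
  intro k
  induction k using Nat.strong_induction_on with
  | _ k ihk =>
  intro l
  induction l using Nat.strong_induction_on with
  | _ l ihl =>
  intro a b c d e f hak hAl ha hA hdet x y z
  obtain ⟨k1, h1, h2⟩ := near_shift (a * e - b * c) (a * d - b ^ 2) hA
  obtain ⟨c', hc'⟩ : ∃ c', c' = c + k1 * b := ⟨_, rfl⟩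
  obtain ⟨e', he'⟩ : ∃ e', e' = e + k1 * d := ⟨_, rfl⟩
  obtain ⟨f', hf'⟩ : ∃ f', f' = f + 2 * k1 * e + k1 ^ 2 * d := ⟨_, rfl⟩
  have hdet' : a * d * f' + 2 * b * c' * e' - a * e' ^ 2 - d * c' ^ 2 - f' * b ^ 2 = 1 := by
    rw [← hdet, hc', he', hf']; ring
  have hB : a * e - b * c + k1 * (a * d - b ^ 2) = a * e' - b * c' := by
    rw [hc', he']; ring
  rw [hB] at h1 h2
  have hrel : (a * d - b ^ 2) * (a * f' - c' ^ 2) - (a * e' - b * c') ^ 2 = a := by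
    linear_combination a * hdet'
  have hCpos : 0 < a * f' - c' ^ 2 := by
    by_contra hcon
    nlinarith [sq_nonneg (a * e' - b * c'), mul_nonneg hA.le (show 0 ≤ -(a * f' - c' ^ 2) by linarith)]
  by_cases hC : a * f' - c' ^ 2 < a * d - b ^ 2
  · obtain ⟨r, s, t, h⟩ := ihl (a * f' - c' ^ 2).toNat (by omega) a c' b f' e' d hak rfl ha hCpos
      (by rw [← hdet']; ring) x z (y - k1 * z)
    refine ⟨r, s, t, ?_⟩
    rw [← h, hc', he', hf']; ring
  · obtain ⟨k2, g1, g2⟩ := near_shift b a ha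
    obtain ⟨b2, hb2⟩ : ∃ b2, b2 = b + k2 * a := ⟨_, rfl⟩
    obtain ⟨d2, hd2⟩ : ∃ d2, d2 = d + 2 * k2 * b + k2 ^ 2 * a := ⟨_, rfl⟩
    obtain ⟨e2, he2⟩ : ∃ e2, e2 = e' + k2 * c' := ⟨_, rfl⟩
    have hA2 : a * d2 - b2 ^ 2 = a * d - b ^ 2 := by rw [hb2, hd2]; ring
    have hB2 : a * e2 - b2 * c' = a * e' - b * c' := by rw [hb2, he2]; ring
    have hdet2 : a * d2 * f' + 2 * b2 * c' * e2 - a * e2 ^ 2 - d2 * c' ^ 2 - f' * b2 ^ 2 = 1 := by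
      rw [← hdet', hb2, hd2, he2]; ring
    rw [← hb2] at g1 g2
    have hd2pos : 0 < d2 := by
      by_contra hcon
      nlinarith [sq_nonneg b2, mul_nonneg ha.le (show 0 ≤ -d2 by linarith)]
    have : ∃ r s t : ℤ, a * (x - k2 * (y - k1 * z)) ^ 2 + d2 * (y - k1 * z) ^ 2 + f' * z ^ 2
        + 2 * b2 * (x - k2 * (y - k1 * z)) * (y - k1 * z)
        + 2 * c' * (x - k2 * (y - k1 * z)) * z
        + 2 * e2 * (y - k1 * z) * z = r ^ 2 + s ^ 2 + t ^ 2 := by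
      by_cases hda : d2 < a
      · obtain ⟨r, s, t, h⟩ := ihk d2.toNat (by omega) (d2 * a - b2 ^ 2).toNat d2 b2 e2 a c' f' rfl
          rfl hd2pos (by linarith) (by rw [← hdet2]; ring)
          (y - k1 * z) (x - k2 * (y - k1 * z)) z
        refine ⟨r, s, t, ?_⟩
        rw [← h]; ring
      · exact tern_reduced a b2 c' d2 e2 f' ha (by linarith) hdet2 (by linarith) (by linarith)
          (by linarith) g1 g2 (by linarith) _ _ _
    obtain ⟨r, s, t, h⟩ := this
    refine ⟨r, s, t, ?_⟩
    rw [← h, he2, hb2, hd2, hc', he', hf']; ring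

open NumberTheorySymbols in
/-- Sums of three squares, for `n ≡ 1 (mod 8)`. -/
lemma three_squares (t : ℕ) : ∃ r s u : ℤ, (8 * t + 1 : ℤ) = r ^ 2 + s ^ 2 + u ^ 2 := by
  have hcop : Nat.Coprime (12 * t + 1) (4 * (8 * t + 1)) := by
    rw [Nat.coprime_mul_iff_right]
    constructor
    · rw [show 12 * t + 1 = 1 + 4 * (3 * t) by ring]
      simp
    · rw [← Nat.isCoprime_iff_coprime]
      exact ⟨-2, 3, by push_cast; ring⟩
  obtain ⟨p, hpgt, hp, hmod⟩ := Nat.forall_exists_prime_gt_and_modEq (12 * t + 1)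
    (show 4 * (8 * t + 1) ≠ 0 by omega) hcop
  obtain ⟨j, hj⟩ := (Nat.modEq_iff_dvd' hpgt.le).1 hmod.symm
  have hpj : p = 4 * (8 * t + 1) * j + (12 * t + 1) := by omega
  have : Fact p.Prime := ⟨hp⟩
  have hp4 : p % 4 = 1 := by
    rw [hpj, mul_assoc]; omega
  have hpodd : Odd p := Nat.odd_iff.2 (by omega)
  obtain ⟨d, hd⟩ : ∃ d, d = 8 * j + 3 := ⟨_, rfl⟩
  have hdodd : Odd d := Nat.odd_iff.2 (by omega)
  have hdn : (d : ℤ) * (8 * t + 1) = 2 * p + 1 := by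
    rw [hd, hpj]; push_cast; ring
  have hJ : J(-(d : ℤ) | p) = 1 := by
    rw [jacobiSym.neg _ hpodd, ZMod.χ₄_nat_one_mod_four hp4, one_mul,
      jacobiSym.quadratic_reciprocity_one_mod_four' hdodd hp4]
    have h1 : J((2 * p : ℤ) | d) = J(-1 | d) := by
      apply jacobiSym.mod_left'
      apply Int.ModEq.symm
      apply Int.modEq_iff_dvd.2
      exact ⟨8 * t + 1, by linarith⟩
    have h2 : J(2 | d) = -1 := by
      rw [jacobiSym.at_two hdodd, ZMod.χ₈_nat_mod_eight, show d % 8 = 3 by omega]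
      decide
    have h3 : J(-1 | d) = -1 := by
      rw [jacobiSym.at_neg_one hdodd, ZMod.χ₄_nat_mod_four, show d % 4 = 3 by omega]
      decide
    rw [jacobiSym.mul_left, h2, h3] at h1
    linarith
  have hsq := ZMod.isSquare_of_jacobiSym_eq_one hJ
  obtain ⟨r0, hr0⟩ := hsq
  obtain ⟨r1, hr1⟩ : ∃ r1 : ℤ, (p : ℤ) ∣ r1 ^ 2 + d := by
    refine ⟨(r0.val : ℤ), ?_⟩
    rw [← ZMod.intCast_zmod_eq_zero_iff_dvd]
    push_cast at hr0 ⊢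
    rw [ZMod.natCast_zmod_val, pow_two, ← hr0]
    ring
  obtain ⟨r, hr, hrodd⟩ : ∃ r : ℤ, (p : ℤ) ∣ r ^ 2 + d ∧ r % 2 = 1 := by
    rcases Int.emod_two_eq_zero_or_one r1 with h | h
    · refine ⟨r1 + p, ?_, by omega⟩
      rw [show (r1 + p) ^ 2 + (d : ℤ) = r1 ^ 2 + d + p * (2 * r1 + p) by ring]
      exact dvd_add hr1 (dvd_mul_right _ _)
    · exact ⟨r1, hr1, h⟩
  have h2 : (2 : ℤ) ∣ r ^ 2 + d := by
    obtain ⟨q, hq⟩ : ∃ q, r = 2 * q + 1 := ⟨r / 2, by omega⟩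
    refine ⟨2 * q ^ 2 + 2 * q + 4 * j + 2, ?_⟩
    rw [hq, hd]; push_cast; ring
  have h2p : (2 * p : ℤ) ∣ r ^ 2 + d := by
    apply IsCoprime.mul_dvd _ h2 hr
    have : Nat.Coprime 2 p := (Nat.coprime_two_left).2 hpodd
    exact_mod_cast (Nat.isCoprime_iff_coprime.2 this)
  obtain ⟨A, hA⟩ := h2p
  have hp0 : (0 : ℤ) < p := by exact_mod_cast hp.pos
  have hd0 : (0 : ℤ) < d := by rw [hd]; positivity
  have hApos : 0 < A := by
    by_contra hcon
    nlinarith [sq_nonneg r, mul_nonneg hp0.le (show 0 ≤ -A by linarith)]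
  obtain ⟨x, y, z, h⟩ := tern _ _ A r 1 (2 * p) 0 (8 * t + 1) rfl rfl hApos
    (by nlinarith) (by linear_combination hdn - (8 * (t : ℤ) + 1) * hA) 0 0 1
  exact ⟨x, y, z, by rw [← h]; ring⟩

lemma form_236 (n x y z : ℤ) (hn : n % 3 ≠ 1) (h : n = x ^ 2 + y ^ 2 + z ^ 2) :
    ∃ u v w : ℤ, n = 2 * u ^ 2 + 3 * v ^ 2 + 6 * w ^ 2 := by
  -- arrange the parity
  obtain ⟨x, y, z, h, hpar⟩ : ∃ x y z : ℤ, n = x ^ 2 + y ^ 2 + z ^ 2 ∧ (x + y) % 2 = 0 := by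
    rcases Int.emod_two_eq_zero_or_one (x + y) with h1 | h1
    · exact ⟨x, y, z, h, h1⟩
    rcases Int.emod_two_eq_zero_or_one (x + z) with h2 | h2
    · exact ⟨x, z, y, by rw [h]; ring, h2⟩
    · exact ⟨y, z, x, by rw [h]; ring, by omega⟩
  -- arrange the signs
  obtain ⟨x, y, z, h, hpar, h3⟩ : ∃ x y z : ℤ, n = x ^ 2 + y ^ 2 + z ^ 2 ∧ (x + y) % 2 = 0 ∧
      (x + y + z) % 3 = 0 := by
    have hor : (x + y + z) % 3 = 0 ∨ (x + y - z) % 3 = 0 ∨ (x - y + z) % 3 = 0 ∨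
        (x - y - z) % 3 = 0 := by
      have hx : x % 3 = 0 ∨ x % 3 = 1 ∨ x % 3 = 2 := by omega
      have hy : y % 3 = 0 ∨ y % 3 = 1 ∨ y % 3 = 2 := by omega
      have hz : z % 3 = 0 ∨ z % 3 = 1 ∨ z % 3 = 2 := by omega
      rw [h] at hn
      rcases hx with hx | hx | hx <;> rcases hy with hy | hy | hy <;>
        rcases hz with hz | hz | hz <;>
        first
        | omega
        | (exfalso; simp [pow_two, Int.add_emod, Int.mul_emod, hx, hy, hz] at hn)
    rcases hor with h' | h' | h' | h'
    · exact ⟨x, y, z, h, hpar, h'⟩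
    · exact ⟨x, y, -z, by rw [h]; ring, hpar, by omega⟩
    · exact ⟨x, -y, z, by rw [h]; ring, by omega, by omega⟩
    · exact ⟨x, -y, -z, by rw [h]; ring, by omega, by omega⟩
  obtain ⟨v, hv⟩ : ∃ v, x + y + z = 3 * v := ⟨(x + y + z) / 3, by omega⟩
  obtain ⟨w, hw⟩ : ∃ w, x + y - 2 * z = 6 * w := ⟨(x + y - 2 * z) / 6, by omega⟩
  obtain ⟨u, hu⟩ : ∃ u, x - y = 2 * u := ⟨(x - y) / 2, by omega⟩
  refine ⟨u, v, w, ?_⟩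
  have hz : z = v - 2 * w := by linarith
  have hx : x = v + w + u := by linarith
  have hy : y = v + w - u := by linarith
  rw [h, hx, hy, hz]; ring

lemma cauchy_1122 (a b x y z : ℤ) (hab : (a - b) % 2 = 0)
    (h : 6 * a - b ^ 2 = x ^ 2 + y ^ 2 + z ^ 2) :
    ∃ p q r s : ℤ, a = p ^ 2 + q ^ 2 + 2 * r ^ 2 + 2 * s ^ 2 ∧ b = p + q + 2 * r + 2 * s := by
  have hb3 : b % 3 = 0 ∨ b % 3 = 1 ∨ b % 3 = 2 := by omega
  obtain ⟨u, v, w, h⟩ := form_236 (6 * a - b ^ 2) x y z (by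
    rcases hb3 with hb | hb | hb <;>
      simp [pow_two, Int.sub_emod, Int.mul_emod, hb]) h
  obtain ⟨u, h, hu⟩ : ∃ u, 6 * a - b ^ 2 = 2 * u ^ 2 + 3 * v ^ 2 + 6 * w ^ 2 ∧
      (b - u) % 3 = 0 := by
    have hor : (b - u) % 3 = 0 ∨ (b + u) % 3 = 0 := by
      have hd : (3 : ℤ) ∣ (b - u) * (b + u) :=
        ⟨2 * a - u ^ 2 - v ^ 2 - 2 * w ^ 2, by linear_combination -h⟩
      rcases Int.Prime.dvd_mul' Nat.prime_three hd with h' | h' <;> push_cast at h' <;> omega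
    rcases hor with h' | h'
    · exact ⟨u, h, h'⟩
    · exact ⟨-u, by rw [h]; ring, by omega⟩
  obtain ⟨R, hR⟩ : ∃ R, b = u + 3 * R := ⟨(b - u) / 3, by omega⟩
  obtain ⟨e, he⟩ : ∃ e, a = b + 2 * e := ⟨(a - b) / 2, by omega⟩
  -- parity of `v`
  have hvb : (b - v) % 2 = 0 := by
    have h1 : (b ^ 2 - v ^ 2) % 2 = 0 := by
      have : b ^ 2 - v ^ 2 = 2 * (3 * a - u ^ 2 - 2 * v ^ 2 - 3 * w ^ 2) := by
        linear_combination -h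
      omega
    rcases Int.emod_two_eq_zero_or_one b with hb | hb <;>
      rcases Int.emod_two_eq_zero_or_one v with hv | hv <;>
      simp [pow_two, Int.sub_emod, Int.mul_emod, hb, hv] at h1 ⊢
  obtain ⟨g, hg⟩ : ∃ g, v = b + 2 * g := ⟨(v - b) / 2, by omega⟩
  have hw : (R - w) % 2 = 0 := by
    have h1 : 3 * b + 6 * e = u ^ 2 + 2 * b ^ 2 + 6 * b * g + 6 * g ^ 2 + 3 * w ^ 2 := by
      have : 2 * (3 * b + 6 * e) =
          2 * (u ^ 2 + 2 * b ^ 2 + 6 * b * g + 6 * g ^ 2 + 3 * w ^ 2) := by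
        rw [hg, he] at h
        linear_combination h
      linarith
    have h2 : (b - u ^ 2 - w ^ 2) % 2 = 0 := by
      have : b - u ^ 2 - w ^ 2 = 2 * (b ^ 2 + 3 * b * g + 3 * g ^ 2 + w ^ 2 - b - 3 * e) := by
        linear_combination h1
      omega
    have h3 : (b - u - w) % 2 = 0 := by
      rcases Int.emod_two_eq_zero_or_one u with hb | hb <;>
      rcases Int.emod_two_eq_zero_or_one w with hv | hv <;>
      simp [pow_two, Int.sub_emod, Int.mul_emod, hb, hv] at h2 ⊢ <;> omega
    omega
  obtain ⟨r, hr⟩ : ∃ r, R + w = 2 * r := ⟨(R + w) / 2, by omega⟩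
  obtain ⟨s, hs⟩ : ∃ s, R - w = 2 * s := ⟨(R - w) / 2, by omega⟩
  obtain ⟨p, hp⟩ : ∃ p, b - 2 * R + v = 2 * p := ⟨(b - 2 * R + v) / 2, by omega⟩
  obtain ⟨q, hq⟩ : ∃ q, b - 2 * R - v = 2 * q := ⟨(b - 2 * R - v) / 2, by omega⟩
  refine ⟨p, q, r, s, ?_, by linarith⟩
  have hR' : R = r + s := by linarith
  have hw' : w = r - s := by linarith
  have hv' : v = p - q := by linarith
  have hb' : b = p + q + 2 * r + 2 * s := by linarith
  have hu' : u = p + q - r - s := by linarith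
  rw [hb', hu', hv', hw'] at h
  have : 6 * a = 6 * (p ^ 2 + q ^ 2 + 2 * r ^ 2 + 2 * s ^ 2) := by linear_combination h
  linarith

lemma nonneg_1122 (a b p q r s : ℤ) (hb : 0 ≤ b) (hab : 5 * a ≤ b ^ 2 + 2 * b + 5)
    (h1 : a = p ^ 2 + q ^ 2 + 2 * r ^ 2 + 2 * s ^ 2) (h2 : b = p + q + 2 * r + 2 * s) :
    0 ≤ p ∧ 0 ≤ r := by
  constructor
  · by_contra hcon
    have hp : p ≤ -1 := by omega
    have hcs : (b - p) ^ 2 ≤ 5 * (a - p ^ 2) := by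
      rw [h1, h2]
      nlinarith [sq_nonneg (q - r), sq_nonneg (q - s), sq_nonneg (r - s)]
    nlinarith
  · by_contra hcon
    have hr : r ≤ -1 := by omega
    have hcs : (b - 2 * r) ^ 2 ≤ 4 * (a - 2 * r ^ 2) := by
      rw [h1, h2]
      nlinarith [sq_nonneg (p - q), sq_nonneg (p - s), sq_nonneg (q - s)]
    nlinarith

lemma zmod_choice : ∀ M N : ZMod 8, ∃ k : ZMod 8,
    3 * (k + (N - 2 * M * k)) - (N - 2 * M * k) ^ 2 = 1 := by
  decide

lemma residue_choice (m N : ℤ) (hpar : m % 2 = 1 ∨ m % 4 = 0) :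
    ∃ κ : ℤ, ∀ q k b : ℤ, k = κ - 8 * q → b = N - m * k →
      (b % 2 = 1 ∧ (12 * k + 6 * b - b ^ 2) % 8 = 1) ∨
      (∃ c : ℤ, b = 2 * c ∧ (3 * (k + c) - c ^ 2) % 8 = 1) := by
  have odd_case : ∀ κ : ℤ, (N - m * κ) % 2 = 1 → (2 * κ + 3 * (N - m * κ)) % 4 = 1 →
      ∀ q k b : ℤ, k = κ - 8 * q → b = N - m * k →
      (b % 2 = 1 ∧ (12 * k + 6 * b - b ^ 2) % 8 = 1) := by
    intro κ h1 h2 q k b hk hb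
    have hb' : b = (N - m * κ) + 8 * (m * q) := by rw [hb, hk]; ring
    have hbo : b % 2 = 1 := by omega
    refine ⟨hbo, ?_⟩
    have hsq : b ^ 2 % 8 = 1 := by
      have h8 : b % 8 = 1 ∨ b % 8 = 3 ∨ b % 8 = 5 ∨ b % 8 = 7 := by omega
      rcases h8 with h8 | h8 | h8 | h8 <;> simp [pow_two, Int.mul_emod, h8]
    omega
  rcases hpar with hm | hm
  · have : ∃ κ : ℤ, (N - m * κ) % 2 = 1 ∧ (2 * κ + 3 * (N - m * κ)) % 4 = 1 := by
      have h1 : m % 4 = 1 ∨ m % 4 = 3 := by omega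
      have h2 : N % 4 = 0 ∨ N % 4 = 1 ∨ N % 4 = 2 ∨ N % 4 = 3 := by omega
      rcases h1 with h1 | h1 <;> rcases h2 with h2 | h2 | h2 | h2 <;>
        first
        | exact ⟨0, by omega, by omega⟩
        | exact ⟨1, by omega, by omega⟩
        | exact ⟨2, by omega, by omega⟩
        | exact ⟨3, by omega, by omega⟩
    obtain ⟨κ, h1, h2⟩ := this
    exact ⟨κ, fun q k b hk hb => Or.inl (odd_case κ h1 h2 q k b hk hb)⟩
  · rcases Int.emod_two_eq_zero_or_one N with hN | hN
    · obtain ⟨M, rfl⟩ : ∃ M, m = 4 * M := ⟨m / 4, by omega⟩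
      obtain ⟨N', rfl⟩ : ∃ N', N = 2 * N' := ⟨N / 2, by omega⟩
      obtain ⟨κ, hκ⟩ := zmod_choice (M : ZMod 8) (N' : ZMod 8)
      refine ⟨(κ.val : ℤ), fun q k b hk hb => Or.inr ⟨N' - 2 * M * k, by rw [hb]; ring, ?_⟩⟩
      have hk' : (k : ZMod 8) = κ := by
        rw [hk]; push_cast
        rw [ZMod.natCast_zmod_val, show (8 : ZMod 8) = 0 from rfl]; ring
      rw [← hk'] at hκ
      have : ((3 * (k + (N' - 2 * M * k)) - (N' - 2 * M * k) ^ 2 : ℤ) : ZMod 8) = ((1 : ℤ) : ZMod 8) := by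
        push_cast; exact hκ
      exact (ZMod.intCast_eq_intCast_iff' _ _ 8).1 this
    · have : ∃ κ : ℤ, (N - m * κ) % 2 = 1 ∧ (2 * κ + 3 * (N - m * κ)) % 4 = 1 := by
        have h2 : N % 4 = 1 ∨ N % 4 = 3 := by omega
        rcases h2 with h2 | h2
        · exact ⟨1, by omega, by omega⟩
        · exact ⟨0, by omega, by omega⟩
      obtain ⟨κ, h1, h2⟩ := this
      exact ⟨κ, fun q k b hk hb => Or.inl (odd_case κ h1 h2 q k b hk hb)⟩

lemma three_squares_int (n : ℤ) (hn : 0 ≤ n) (h8 : n % 8 = 1) :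
    ∃ x y z : ℤ, n = x ^ 2 + y ^ 2 + z ^ 2 := by
  obtain ⟨x, y, z, h⟩ := three_squares (n / 8).toNat
  exact ⟨x, y, z, by rw [← h]; omega⟩

lemma two_polygonal (m n : ℕ) : (2 * polygonal m n : ℤ) = m * ((n : ℤ) ^ 2 - n) + 2 * n := by
  unfold polygonal
  have h2 : 2 ∣ m * (n * (n - 1)) := by
    apply Dvd.dvd.mul_left
    exact (Nat.even_mul_pred_self n).two_dvd
  obtain ⟨c, hc⟩ := h2
  have hc' : (m : ℤ) * ((n : ℤ) ^ 2 - n) = 2 * c := by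
    rcases n with _ | n
    · simp at hc ⊢; omega
    · simp only [Nat.add_sub_cancel] at hc
      have : ((m * ((n + 1) * n) : ℕ) : ℤ) = ((2 * c : ℕ) : ℤ) := by rw [hc]
      push_cast at this ⊢
      linarith
  rw [hc, Nat.mul_div_cancel_left c (by norm_num), hc']
  push_cast; ring

theorem sum_polygonal_1122 (m : ℕ) (hm : 3 ≤ m) (hpar : ¬ 2 ∣ m ∨ 4 ∣ m)
    (N : ℕ) (hN : 1628 * m ^ 3 ≤ N) :
    ∃ x₁ x₂ x₃ x₄ : ℕ,
      N = polygonal m x₁ + polygonal m x₂ + 2 * polygonal m x₃ + 2 * polygonal m x₄ := by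
  obtain ⟨κ, hκ⟩ := residue_choice m N (by omega)
  have hm0 : (3 : ℤ) ≤ m := by exact_mod_cast hm
  have hNZ : (1628 : ℤ) * m ^ 3 ≤ N := by exact_mod_cast hN
  obtain ⟨s, hs1, hs2⟩ : ∃ s : ℕ, m * s ^ 2 ≤ 12 * N ∧ 12 * N < m * (s + 1) ^ 2 := by
    refine ⟨Nat.sqrt (12 * N / m), ?_, ?_⟩
    · have h1 := Nat.sqrt_le' (12 * N / m)
      calc m * (Nat.sqrt (12 * N / m)) ^ 2 ≤ m * (12 * N / m) := Nat.mul_le_mul_left _ h1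
        _ ≤ 12 * N := Nat.mul_div_le _ _
    · have h1 := Nat.lt_succ_sqrt' (12 * N / m)
      rw [Nat.div_lt_iff_lt_mul (by omega)] at h1
      rw [mul_comm m]; exact h1
  have hs1' : (m : ℤ) * (s : ℤ) ^ 2 ≤ 12 * N := by exact_mod_cast hs1
  have hs2' : 12 * (N : ℤ) < m * ((s : ℤ) + 1) ^ 2 := by exact_mod_cast hs2
  obtain ⟨u, hu⟩ : ∃ u : ℤ, u = s - (N - m * κ) := ⟨_, rfl⟩
  obtain ⟨q, hq⟩ : ∃ q : ℤ, q = u / (8 * m) := ⟨_, rfl⟩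
  obtain ⟨k, hk⟩ : ∃ k : ℤ, k = κ - 8 * q := ⟨_, rfl⟩
  obtain ⟨b, hb⟩ : ∃ b : ℤ, b = N - m * k := ⟨_, rfl⟩
  have hbu : b = s - u % (8 * m) := by
    have := Int.emod_add_mul_ediv u (8 * m)
    rw [← hq] at this
    rw [hb, hk]; linear_combination this + hu
  have hu1 := Int.emod_nonneg u (show (8 * m : ℤ) ≠ 0 by omega)
  have hu2 := Int.emod_lt_of_pos u (show (0 : ℤ) < 8 * m by omega)
  have hbs : b ≤ s := by omega
  have hbs2 : (s : ℤ) + 1 - 8 * m ≤ b := by omega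
  have hmpos : (0 : ℤ) < m := by omega
  have hs102 : 102 * (m : ℤ) ≤ s + 1 := by
    by_contra hcon
    have h1 : ((s : ℤ) + 1) ^ 2 ≤ (102 * m) ^ 2 := by
      apply pow_le_pow_left₀ <;> omega
    have h2 := mul_le_mul_of_nonneg_left h1 hmpos.le
    have h3 : (0 : ℤ) < m ^ 3 := by positivity
    nlinarith
  have hb0 : 0 < b := by omega
  have hbm : (m : ℤ) * b ^ 2 ≤ 12 * N := by
    refine le_trans ?_ hs1'
    apply mul_le_mul_of_nonneg_left _ hmpos.le
    apply pow_le_pow_left₀ hb0.le hbs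
  have hlow : 10 * (N : ℤ) ≤ m * (b * (b - 3)) := by
    have h1 : ((s : ℤ) + 1 - 8 * m) * (s + 1 - 9 * m) ≤ b * (b - 3) := by
      apply mul_le_mul hbs2 <;> omega
    have h2 : 5 * ((s : ℤ) + 1) ^ 2 ≤ 6 * (((s : ℤ) + 1 - 8 * m) * (s + 1 - 9 * m)) := by
      nlinarith [mul_nonneg (show (0 : ℤ) ≤ s + 1 by omega) (show (0 : ℤ) ≤ s + 1 - 102 * m by omega)]
    have h3 : 5 * ((s : ℤ) + 1) ^ 2 ≤ 6 * (b * (b - 3)) := by linarith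
    have h4 := mul_le_mul_of_nonneg_left h3 hmpos.le
    linarith
  obtain ⟨a, ha⟩ : ∃ a : ℤ, a = 2 * k + b := ⟨_, rfl⟩
  have hma : (m : ℤ) * a = 2 * N + b * (m - 2) := by rw [ha, hb]; ring
  have hpos : 0 ≤ 6 * a - b ^ 2 := by
    by_contra hcon
    have h1 : (m : ℤ) * (6 * a - b ^ 2) < 0 := mul_neg_of_pos_of_neg hmpos (by linarith)
    nlinarith [mul_nonneg hb0.le (show (0 : ℤ) ≤ m - 2 by omega)]
  have hup : 5 * a ≤ b ^ 2 + 2 * b + 5 := by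
    by_contra hcon
    have h1 : (0 : ℤ) < m * (5 * a - (b ^ 2 + 2 * b + 5)) := mul_pos hmpos (by linarith)
    nlinarith
  have hsq : ∃ x y z : ℤ, 6 * a - b ^ 2 = x ^ 2 + y ^ 2 + z ^ 2 := by
    rcases hκ q k b hk hb with ⟨_, h8⟩ | ⟨c, hc, h8⟩
    · apply three_squares_int _ hpos
      rw [← h8, ha]; congr 1; ring
    · have he : 6 * a - b ^ 2 = 4 * (3 * (k + c) - c ^ 2) := by rw [ha, hc]; ring
      obtain ⟨x, y, z, h⟩ := three_squares_int (3 * (k + c) - c ^ 2) (by linarith) h8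
      exact ⟨2 * x, 2 * y, 2 * z, by rw [he, h]; ring⟩
  obtain ⟨x, y, z, h⟩ := hsq
  obtain ⟨p, q', r, t, h1, h2⟩ := cauchy_1122 a b x y z (by omega) h
  obtain ⟨hp, hr⟩ := nonneg_1122 a b p q' r t hb0.le hup h1 h2
  obtain ⟨hq', ht⟩ := nonneg_1122 a b q' p t r hb0.le hup (by linarith) (by linarith)
  lift p to ℕ using hp
  lift q' to ℕ using hq'
  lift r to ℕ using hr
  lift t to ℕ using ht
  refine ⟨p, q', r, t, ?_⟩
  have e1 := two_polygonal m p
  have e2 := two_polygonal m q'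
  have e3 := two_polygonal m r
  have e4 := two_polygonal m t
  have hfin : (2 * N : ℤ) = 2 * (polygonal m p + polygonal m q' + 2 * polygonal m r
      + 2 * polygonal m t) := by
    have : (2 * N : ℤ) = m * (a - b) + 2 * b := by rw [ha, hb]; ring
    rw [this, h1, h2]
    linear_combination -e1 - e2 - 2 * e3 - 2 * e4
  have : (N : ℤ) = (polygonal m p + polygonal m q' + 2 * polygonal m r
      + 2 * polygonal m t) := by linarith
  exact_mod_cast this
end

section
/- Let m ≥ 3 be an integer. Then every integer N ≥ 924m³ can be written as N = p_{m+2}(x₁) + p_{m+2}(x₂) + p_{m+2}(x₃) + 3·p_{m+2}(x₄) for some nonnegative integers x₁, x₂, x₃, x₄. -/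
theorem final_aux {N β γ R T u A K C x y z : ℤ} (hAd : A = 4 * 1 * β - u ^ 2)
    (hK : K = 2 * 1 * R - T * u) (hC : C = 4 * 1 * γ - T ^ 2) (hA3 : 3 ≤ A) (hA4 : A ≤ 4)
    (hAC : A * C - K ^ 2 = 12) (hi1 : -A ≤ 2 * K) (hi2 : 2 * K ≤ A) (h2 : A ≤ C)
    (hj1 : -1 ≤ u) (hj2 : u ≤ 1)
    (h4N : 4 * N = (2 * x + u * y + T * z) ^ 2 + A * y ^ 2 + 2 * K * y * z + C * z ^ 2) :
    ∃ w p q : ℤ, N = w ^ 2 + p ^ 2 + p * q + q ^ 2 := by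
  have hKl : -2 ≤ K := by omega
  have hKu : K ≤ 2 := by omega
  have hu1 : u = -1 ∨ u = 0 ∨ u = 1 := by omega
  obtain rfl | rfl : A = 3 ∨ A = 4 := by omega
  · have : K = 0 := by
      have : K = -1 ∨ K = 0 ∨ K = 1 := by omega
      rcases this with h | h | h
      · rw [h] at hAC; omega
      · exact h
      · rw [h] at hAC; omega
    subst this
    have hC4 : C = 4 := by omega
    have hT : ∃ s, T = 2 * s := by
      rcases hu1 with h | h | h <;> subst h
      · exact ⟨-R, by omega⟩
      · omega
      · exact ⟨R, by omega⟩
    obtain ⟨s, rfl⟩ := hT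
    subst hC4
    refine ⟨z, x + s * z, u * y, ?_⟩
    have : u ^ 2 = 1 := by rcases hu1 with h | h | h <;> subst h <;> first | rfl | omega
    have e : (u * y) ^ 2 = y ^ 2 := by rw [mul_pow, this, one_mul]
    have : 4 * N = 4 * (z ^ 2 + (x + s * z) ^ 2 + (x + s * z) * (u * y)) + (u * y) ^ 2 + 3 * y ^ 2 := by
      rw [h4N]; ring
    linarith
  · have hu0 : u = 0 := by
      rcases hu1 with h | h | h
      · subst h; omega
      · exact h
      · subst h; omega
    subst hu0
    have hC34 : K = 2 ∧ C = 4 ∨ K = -2 ∧ C = 4 := by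
      have : K = -2 ∨ K = -1 ∨ K = 0 ∨ K = 1 ∨ K = 2 := by omega
      rcases this with h | h | h | h | h <;> subst h <;> omega
    have hT : ∃ s, T = 2 * s := by
      have : C = 4 := by omega
      rcases Int.even_or_odd' T with ⟨s, h | h⟩
      · exact ⟨s, h⟩
      · exfalso
        subst h
        have : 4 = 4 * 1 * γ - (4 * (s ^ 2 + s) + 1) := by rw [this] at hC; linarith
        omega
    obtain ⟨s, rfl⟩ := hT
    rcases hC34 with ⟨rfl, h⟩ | ⟨rfl, h⟩
    · refine ⟨x + s * z, y, z, ?_⟩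
      rw [h] at h4N; linarith
    · refine ⟨x + s * z, y, -z, ?_⟩
      rw [h] at h4N; linarith

set_option maxHeartbeats 1000000 in
/-- Any positive ternary form of half-discriminant 3 represents only numbers represented by
`w² + p² + pq + q²`. -/
theorem reduce_aux (N : ℤ) : ∀ (k l : ℕ) (α β γ r t u : ℤ), α.toNat = k →
    (4 * α * β - u ^ 2).toNat = l → 0 < α → 0 < 4 * α * β - u ^ 2 →
    4 * α * β * γ + r * t * u - α * r ^ 2 - β * t ^ 2 - γ * u ^ 2 = 3 →
    (∃ x y z : ℤ, α * x ^ 2 + β * y ^ 2 + γ * z ^ 2 + r * y * z + t * x * z + u * x * y = N) →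
    ∃ w p q : ℤ, N = w ^ 2 + p ^ 2 + p * q + q ^ 2 := by
  intro k
  induction k using Nat.strong_induction_on with
  | _ k ihk =>
  intro l
  induction l using Nat.strong_induction_on with
  | _ l ihl =>
  intro α β γ r t u hk hl hα hA hd ⟨x, y, z, hN⟩
  obtain ⟨j, hj1, hj2⟩ : ∃ j : ℤ, -α ≤ u + 2 * α * j ∧ u + 2 * α * j ≤ α := by
    refine ⟨-((u + α) / (2 * α)), ?_, ?_⟩
    · have := Int.mul_ediv_add_emod (u + α) (2 * α)
      have := Int.emod_nonneg (u + α) (b := 2 * α) (by omega)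
      linarith
    · have := Int.mul_ediv_add_emod (u + α) (2 * α)
      have := Int.emod_lt_of_pos (u + α) (b := 2 * α) (by omega)
      linarith
  obtain ⟨u', hu'⟩ : ∃ u', u' = u + 2 * α * j := ⟨_, rfl⟩
  obtain ⟨β', hβ'⟩ : ∃ β', β' = β + u * j + α * j ^ 2 := ⟨_, rfl⟩
  obtain ⟨r', hr'⟩ : ∃ r', r' = r + t * j := ⟨_, rfl⟩
  have eA : 4 * α * β' - u' ^ 2 = 4 * α * β - u ^ 2 := by subst hu' hβ'; ring
  have ed : 4 * α * β' * γ + r' * t * u' - α * r' ^ 2 - β' * t ^ 2 - γ * u' ^ 2 = 3 := by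
    rw [← hd]; subst hu' hβ' hr'; ring
  have eN : α * (x - j * y) ^ 2 + β' * y ^ 2 + γ * z ^ 2 + r' * y * z + t * (x - j * y) * z
      + u' * (x - j * y) * y = N := by
    rw [← hN]; subst hu' hβ' hr'; ring
  rw [← hu'] at hj1 hj2
  rw [← eA] at hA hl
  generalize x - j * y = x' at eN
  clear hN hd eA hu' hβ' hr'
  obtain ⟨A, hAd⟩ : ∃ A, A = 4 * α * β' - u' ^ 2 := ⟨_, rfl⟩
  obtain ⟨H, hH⟩ : ∃ H, H = 2 * α * r' - t * u' := ⟨_, rfl⟩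
  rw [← hAd] at hA hl
  obtain ⟨i, hi1, hi2⟩ : ∃ i : ℤ, -A ≤ 2 * (H + A * i) ∧ 2 * (H + A * i) ≤ A := by
    refine ⟨-((2 * H + A) / (2 * A)), ?_, ?_⟩
    · have := Int.mul_ediv_add_emod (2 * H + A) (2 * A)
      have := Int.emod_nonneg (2 * H + A) (b := 2 * A) (by omega)
      linarith
    · have := Int.mul_ediv_add_emod (2 * H + A) (2 * A)
      have := Int.emod_lt_of_pos (2 * H + A) (b := 2 * A) (by omega)
      linarith
  obtain ⟨γ', hγ'⟩ : ∃ γ', γ' = γ + r' * i + β' * i ^ 2 := ⟨_, rfl⟩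
  obtain ⟨R, hR⟩ : ∃ R, R = r' + 2 * β' * i := ⟨_, rfl⟩
  obtain ⟨T, hT⟩ : ∃ T, T = t + u' * i := ⟨_, rfl⟩
  have fd : 4 * α * β' * γ' + R * T * u' - α * R ^ 2 - β' * T ^ 2 - γ' * u' ^ 2 = 3 := by
    rw [← ed]; subst hγ' hR hT; ring
  have fN : α * x' ^ 2 + β' * (y - i * z) ^ 2 + γ' * z ^ 2 + R * (y - i * z) * z + T * x' * z
      + u' * x' * (y - i * z) = N := by
    rw [← eN]; subst hγ' hR hT; ring
  have fH : H + A * i = 2 * α * R - T * u' := by subst hH hAd hR hT; ring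
  rw [fH] at hi1 hi2
  generalize y - i * z = y' at fN
  clear eN ed hγ' hR hT fH hH
  by_cases h1 : β' < α
  ·
    have hβpos : 0 < β' := by
      by_contra hc
      nlinarith [sq_nonneg u', mul_nonneg hα.le (sub_nonneg.2 (not_lt.1 hc))]
    exact ihk β'.toNat (by omega) _ β' α γ' T R u' rfl rfl hβpos
      (by linarith [mul_comm α β']) (by linarith) ⟨y', x', z, by linarith⟩
  obtain ⟨C, hC⟩ : ∃ C, C = 4 * α * γ' - T ^ 2 := ⟨_, rfl⟩
  obtain ⟨K, hK⟩ : ∃ K, K = 2 * α * R - T * u' := ⟨_, rfl⟩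
  rw [← hK] at hi1 hi2
  have hAC : A * C - K ^ 2 = 12 * α := by
    have : A * C - K ^ 2 = 4 * α * (4 * α * β' * γ' + R * T * u' - α * R ^ 2 - β' * T ^ 2 - γ' * u' ^ 2) := by
      subst hAd hC hK; ring
    rw [this, fd]; ring
  by_cases h2 : C < A
  · have hCpos : 0 < C := by
      by_contra hc
      nlinarith [sq_nonneg K, mul_nonneg hA.le (sub_nonneg.2 (not_lt.1 hc))]
    refine ihl C.toNat (by omega) α γ' β' R u' T hk (by rw [← hC]) hα (by rw [← hC]; exact hCpos)
      (by linarith) ⟨x', z, y', by linarith⟩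
  push Not at h1 h2
  have hK2 : 4 * K ^ 2 ≤ A ^ 2 := by nlinarith
  have hA2 : A ^ 2 ≤ 16 * α := by nlinarith
  have hu2 : u' ^ 2 ≤ α ^ 2 := by nlinarith
  have hA3 : 3 * α ^ 2 ≤ A := by nlinarith
  have hα1 : α = 1 := by
    by_contra hne
    have h2α : 2 ≤ α := by omega
    nlinarith [mul_nonneg (sub_nonneg.2 hA3) (sub_nonneg.2 hA3), mul_nonneg (sub_nonneg.2 hA3) (sq_nonneg α), pow_le_pow_left₀ (by norm_num) h2α 3]
  subst hα1
  have hA4 : A ≤ 4 := by nlinarith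
  have h4N : 4 * N = (2 * x' + u' * y' + T * z) ^ 2 + A * y' ^ 2 + 2 * K * y' * z + C * z ^ 2 := by
    rw [← fN, hAd, hK, hC]; ring
  exact final_aux hAd hK hC (by linarith) hA4 (by linarith) hi1 hi2 h2 hj1 hj2 h4N

theorem repr_of_form {n α p w t c : ℤ} (hp : 0 < p) (hc : 0 < c) (h : α * p = w ^ 2 + c)
    (hd : 4 * n * c - p * t ^ 2 = 3) : ∃ w p q : ℤ, n = w ^ 2 + p ^ 2 + p * q + q ^ 2 := by
  have hα : 0 < α := by
    by_contra hcon
    nlinarith [sq_nonneg w, mul_nonneg hp.le (sub_nonneg.2 (not_lt.1 hcon))]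
  refine reduce_aux n _ _ α p n 0 t (2 * w) rfl rfl hα ?_ ?_ ⟨0, 0, 1, by ring⟩
  · nlinarith
  · linear_combination hd + 4 * n * h

theorem exists_sqrt {p c : ℕ} (hp : p.Prime) (hp4 : p % 4 = 1) (hJ : jacobiSym p c = 1)
    (hc : c % 4 = 1) : ∃ α w : ℤ, α * p = w ^ 2 + c := by
  have := Fact.mk hp
  have h1 : jacobiSym c p = 1 := by
    rw [jacobiSym.quadratic_reciprocity_one_mod_four hc (Nat.odd_iff.2 (by omega))]; exact hJ
  have h2 : jacobiSym (-c) p = 1 := by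
    rw [jacobiSym.neg _ (Nat.odd_iff.2 (by omega)), h1, ZMod.χ₄_nat_one_mod_four hp4, one_mul]
  rw [← jacobiSym.legendreSym.to_jacobiSym] at h2
  have h0 : ((-c : ℤ) : ZMod p) ≠ 0 := by
    intro h
    rw [(legendreSym.eq_zero_iff p (-c)).2 h] at h2
    norm_num at h2
  obtain ⟨x, hx⟩ := (legendreSym.eq_one_iff p h0).1 h2
  obtain ⟨w, rfl⟩ := ZMod.intCast_surjective x
  have : ((w ^ 2 + c : ℤ) : ZMod p) = 0 := by
    push_cast at hx ⊢
    linear_combination -hx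
  rw [ZMod.intCast_zmod_eq_zero_iff_dvd] at this
  obtain ⟨α, h⟩ := this
  exact ⟨α, w, by linarith⟩

theorem jac_three {c : ℕ} (hc : c % 12 = 1) : jacobiSym 3 c = 1 := by
  rw [jacobiSym.mod_right 3 (Nat.odd_iff.2 (by omega))]
  norm_num [hc]

theorem jac_neg_one {c : ℕ} (hc : c % 12 = 1) : jacobiSym (-1) c = 1 := by
  rw [jacobiSym.at_neg_one (Nat.odd_iff.2 (by omega)), ZMod.χ₄_nat_one_mod_four (by omega)]

theorem repr_one {n : ℕ} (hn : n % 3 ≠ 0) :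
    ∃ w p q : ℤ, (n : ℤ) = w ^ 2 + p ^ 2 + p * q + q ^ 2 := by
  have hcop : (4 * n - 3).Coprime (48 * n) := by
    have h2 : (4 * n - 3).Coprime 2 := by
      rw [Nat.coprime_comm, Nat.coprime_two_left, Nat.odd_iff]; omega
    have h3 : (4 * n - 3).Coprime 3 := by
      rw [Nat.coprime_comm, Nat.Prime.coprime_iff_not_dvd Nat.prime_three]; omega
    have hn' : (4 * n - 3).Coprime n := by
      have hg1 : (4 * n - 3).gcd n ∣ 3 := by
        have h1 := (Nat.gcd_dvd_right (4 * n - 3) n).mul_left 4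
        have h2 := Nat.gcd_dvd_left (4 * n - 3) n
        have := Nat.dvd_sub h1 h2
        rwa [show 4 * n - (4 * n - 3) = 3 by omega] at this
      rcases (Nat.dvd_prime Nat.prime_three).1 hg1 with h | h
      · exact h
      · exfalso
        have := Nat.gcd_dvd_right (4 * n - 3) n
        rw [h] at this; omega
    rw [show 48 * n = 2 ^ 4 * 3 * n by ring]
    exact ((h2.pow_right 4).mul_right h3).mul_right hn'
  obtain ⟨p, hgt, hp, hmod⟩ := Nat.forall_exists_prime_gt_and_modEq (4 * n - 3) (q := 48 * n) (by omega) hcop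
  obtain ⟨k, hk⟩ := (Nat.modEq_iff_dvd' hgt.le).1 hmod.symm
  obtain ⟨c, hc⟩ : ∃ c, c = 12 * k + 1 := ⟨_, rfl⟩
  have hpc : p + 3 = 4 * n * c := by
    have e1 : p = 48 * n * k + (4 * n - 3) := by omega
    have e2 : 4 * n * c = 48 * n * k + 4 * n := by rw [hc]; ring
    omega
  have hJ : jacobiSym p c = 1 := by
    have h1 : jacobiSym (p : ℤ) c = jacobiSym (-1 * 3) c := by
      rw [jacobiSym.mod_left (p : ℤ), jacobiSym.mod_left (-1 * 3)]
      congr 1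
      apply Int.emod_emod_of_dvd _ (dvd_refl _) |>.symm.trans
      rw [Int.emod_emod_of_dvd _ (dvd_refl _)]
      apply Int.ModEq.symm
      rw [Int.modEq_iff_dvd]
      exact ⟨4 * n, by push_cast [← Nat.cast_inj (R := ℤ)] at hpc; linarith⟩
    rw [h1, jacobiSym.mul_left, jac_three (by omega), jac_neg_one (by omega)]; rfl
  have hp4 : p % 4 = 1 := by
    rw [mul_assoc] at hpc; omega
  obtain ⟨α, w, h⟩ := exists_sqrt hp hp4 hJ (by omega)
  refine repr_of_form (t := 1) (by exact_mod_cast hp.pos) (c := c) (by omega) h ?_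
  have : (p : ℤ) + 3 = 4 * n * c := by exact_mod_cast hpc
  linarith

theorem repr_three {n : ℕ} (hn : n % 3 = 1) :
    ∃ w p q : ℤ, (3 * n : ℤ) = w ^ 2 + p ^ 2 + p * q + q ^ 2 := by
  obtain ⟨a, ha⟩ : ∃ a, 3 * a + 1 = 4 * n := ⟨(4 * n - 1) / 3, by omega⟩
  have hcop : a.Coprime (16 * n) := by
    rw [show 16 * n = 4 * (4 * n) by ring, ← ha]
    have h : a.Coprime (3 * a + 1) := by simp
    have h4 : a.Coprime (2 ^ 2) := by
      apply Nat.Coprime.pow_right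
      rw [Nat.coprime_comm, Nat.coprime_two_left, Nat.odd_iff]; omega
    exact h4.mul_right h
  obtain ⟨p, hgt, hp, hmod⟩ := Nat.forall_exists_prime_gt_and_modEq a (q := 16 * n) (by omega) hcop
  obtain ⟨k, hk⟩ := (Nat.modEq_iff_dvd' hgt.le).1 hmod.symm
  obtain ⟨c, hc⟩ : ∃ c, c = 12 * k + 1 := ⟨_, rfl⟩
  have hpc : 3 * p + 1 = 4 * n * c := by
    have e1 : p = 16 * n * k + a := by omega
    have e2 : 4 * n * c = 3 * (16 * n * k) + 4 * n := by rw [hc]; ring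
    omega
  have hJ : jacobiSym p c = 1 := by
    have h1 : jacobiSym (3 * p : ℤ) c = jacobiSym (-1) c := by
      rw [jacobiSym.mod_left (3 * p : ℤ), jacobiSym.mod_left (-1)]
      congr 1
      apply Int.ModEq.symm
      rw [Int.modEq_iff_dvd]
      exact ⟨4 * n, by push_cast [← Nat.cast_inj (R := ℤ)] at hpc; linarith⟩
    rwa [jacobiSym.mul_left, jac_three (by omega), jac_neg_one (by omega), one_mul] at h1
  have hp4 : p % 4 = 1 := by
    rw [mul_assoc] at hpc; omega
  obtain ⟨α, w, h⟩ := exists_sqrt hp hp4 hJ (by omega)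
  refine repr_of_form (t := 3) (by exact_mod_cast hp.pos) (c := c) (by omega) h ?_
  have : 3 * (p : ℤ) + 1 = 4 * n * c := by exact_mod_cast hpc
  linarith

theorem repr_all {D : ℤ} (hD : 0 < D) (h : D % 3 ≠ 0 ∨ D % 9 = 3) :
    ∃ s X Y : ℤ, D = s ^ 2 + X ^ 2 + 3 * Y ^ 2 := by
  have : ∃ w p q : ℤ, D = w ^ 2 + p ^ 2 + p * q + q ^ 2 := by
    rcases h with h | h
    · lift D to ℕ using hD.le
      exact repr_one (by omega)
    · obtain ⟨n, hn⟩ : ∃ n : ℕ, D = 3 * n := ⟨(D / 3).toNat, by omega⟩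
      rw [hn]; exact repr_three (by omega)
  obtain ⟨w, p, q, h⟩ := this
  rcases Int.even_or_odd' p with ⟨p', hp | hp⟩
  · exact ⟨w, q + p', p', by rw [h, hp]; ring⟩
  · rcases Int.even_or_odd' q with ⟨q', hq | hq⟩
    · exact ⟨w, p + q', q', by rw [h, hq]; ring⟩
    · exact ⟨w, p' - q', p' + q' + 1, by rw [h, hp, hq]; ring⟩

theorem parity_arrange {D : ℤ} (hD : D % 4 = 0 ∨ D % 4 = 1)
    (h : ∃ s X Y : ℤ, D = s ^ 2 + X ^ 2 + 3 * Y ^ 2) :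
    ∃ s X Y : ℤ, D = s ^ 2 + X ^ 2 + 3 * Y ^ 2 ∧ X % 2 = Y % 2 := by
  obtain ⟨s, X, Y, h⟩ := h
  by_cases h1 : X % 2 = Y % 2
  · exact ⟨s, X, Y, h, h1⟩
  by_cases h2 : s % 2 = Y % 2
  · exact ⟨X, s, Y, by linarith, h2⟩
  exfalso
  rcases Int.even_or_odd' s with ⟨s, rfl | rfl⟩ <;> rcases Int.even_or_odd' X with ⟨X, rfl | rfl⟩ <;>
  rcases Int.even_or_odd' Y with ⟨Y, rfl | rfl⟩ <;> ring_nf at h <;> omega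

theorem sq_mod_three (x : ℤ) : x % 3 = 0 ∧ x ^ 2 % 3 = 0 ∨ (x % 3 = 1 ∨ x % 3 = 2) ∧ x ^ 2 % 3 = 1 := by
  have : x % 3 = 0 ∨ x % 3 = 1 ∨ x % 3 = 2 := by omega
  rcases this with h | h | h <;> simp [h, pow_two, Int.mul_emod]

set_option maxHeartbeats 1000000 in
theorem cauchy_aux {a b : ℤ} (hab : a % 2 = b % 2) (hb : 0 ≤ b) (h1 : b ^ 2 < 6 * a)
    (h2 : 5 * a < b ^ 2 + 2 * b + 6) (h3 : b % 3 ≠ 0 ∨ a % 3 = 2) :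
    ∃ x y z w : ℤ, 0 ≤ x ∧ 0 ≤ y ∧ 0 ≤ z ∧ 0 ≤ w ∧ x + y + z + 3 * w = b ∧
      x ^ 2 + y ^ 2 + z ^ 2 + 3 * w ^ 2 = a := by
  have hb3 := sq_mod_three b
  have hD4 : (6 * a - b ^ 2) % 4 = 0 ∨ (6 * a - b ^ 2) % 4 = 1 := by
    rcases Int.even_or_odd' b with ⟨c, rfl | rfl⟩ <;> ring_nf <;> omega
  have hD3 : (6 * a - b ^ 2) % 3 ≠ 0 ∨ (6 * a - b ^ 2) % 9 = 3 := by
    by_cases hb0 : b % 3 = 0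
    · right
      obtain ⟨c, rfl⟩ : ∃ c, b = 3 * c := ⟨b / 3, by omega⟩
      ring_nf; omega
    · left; omega
  obtain ⟨s, X, Y, h, hXY⟩ := parity_arrange hD4 (repr_all (by linarith) hD3)
  have hs3 := sq_mod_three s
  have hX3 := sq_mod_three X
  obtain ⟨s', hs', hsb⟩ : ∃ s', s' ^ 2 = s ^ 2 ∧ s' % 3 = b % 3 := by
    by_cases hh : s % 3 = b % 3
    · exact ⟨s, rfl, hh⟩
    · exact ⟨-s, by ring, by omega⟩
  obtain ⟨X', hX', hXb, hXY'⟩ : ∃ X', X' ^ 2 = X ^ 2 ∧ (X' + b) % 3 = 0 ∧ X' % 2 = Y % 2 := by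
    by_cases hh : (X + b) % 3 = 0
    · exact ⟨X, rfl, hh, hXY⟩
    · exact ⟨-X, by ring, by omega, by omega⟩
  rw [← hs', ← hX'] at h
  have hsb2 : s' % 2 = b % 2 := by
    have e1 : s' ^ 2 % 2 = s' % 2 := by
      rcases Int.even_or_odd' s' with ⟨c, rfl | rfl⟩ <;> ring_nf <;> omega
    have e2 : b ^ 2 % 2 = b % 2 := by
      rcases Int.even_or_odd' b with ⟨c, rfl | rfl⟩ <;> ring_nf <;> omega
    have e3 : (X' ^ 2 + 3 * Y ^ 2) % 2 = 0 := by
      rcases Int.even_or_odd' X' with ⟨c, rfl | rfl⟩ <;>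
      rcases Int.even_or_odd' Y with ⟨d, rfl | rfl⟩ <;> ring_nf <;> omega
    omega
  clear hs3 hX3 hs' hX' hXY hb3 hD3 hD4
  obtain ⟨w, hw⟩ : ∃ w, b = s' + 6 * w := ⟨(b - s') / 6, by omega⟩
  obtain ⟨p, hp⟩ : ∃ p, X' = 2 * p + Y := ⟨(X' - Y) / 2, by omega⟩
  obtain ⟨d, hd⟩ : ∃ d, s' = 3 * d + p + 2 * Y := ⟨(s' - p - 2 * Y) / 3, by omega⟩
  have hsum : (d + Y + p + w) + (d + Y + w) + (d + w) + 3 * w = b := by rw [hw, hd]; ring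
  have hsq : (d + Y + p + w) ^ 2 + (d + Y + w) ^ 2 + (d + w) ^ 2 + 3 * w ^ 2 = a := by
    have : 6 * ((d + Y + p + w) ^ 2 + (d + Y + w) ^ 2 + (d + w) ^ 2 + 3 * w ^ 2) = 6 * a := by
      have e : 6 * a = b ^ 2 + (s' ^ 2 + X' ^ 2 + 3 * Y ^ 2) := by linarith
      rw [e, hw, hp, hd]; ring
    linarith
  have key : ∀ x y z w : ℤ, x + y + z + 3 * w = b → x ^ 2 + y ^ 2 + z ^ 2 + 3 * w ^ 2 = a → 0 ≤ x := by
    intro x y z w e1 e2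
    by_contra hx
    have : 5 * (a - x ^ 2) ≥ (b - x) ^ 2 := by
      rw [← e1, ← e2]
      nlinarith [sq_nonneg (y - z), sq_nonneg (y - w), sq_nonneg (z - w)]
    have h7 : 1 ≤ x ^ 2 := by nlinarith
    have h8 : 0 ≤ b * (-1 - x) := mul_nonneg hb (by omega)
    nlinarith only [this, h7, h8, h2, hb]
  have key2 : ∀ x y z w : ℤ, x + y + z + 3 * w = b → x ^ 2 + y ^ 2 + z ^ 2 + 3 * w ^ 2 = a → 0 ≤ w := by
    intro x y z w e1 e2
    by_contra hx
    have h5 : 3 * (a - 3 * w ^ 2) ≥ (b - 3 * w) ^ 2 := by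
      rw [← e1, ← e2]
      nlinarith [sq_nonneg (y - z), sq_nonneg (y - x), sq_nonneg (z - x)]
    have h6 : 0 ≤ a := by nlinarith [sq_nonneg b]
    have h7 : 1 ≤ w ^ 2 := by nlinarith
    have h8 : 0 ≤ b * (-1 - w) := mul_nonneg hb (by omega)
    nlinarith only [h5, h6, h7, h8, h2, hb]
  exact ⟨_, _, _, _, key _ _ _ _ hsum hsq, key _ (d + Y + p + w) (d + w) w (by linarith) (by linarith),
    key _ (d + Y + p + w) (d + Y + w) w (by linarith) (by linarith), key2 _ _ _ _ hsum hsq, hsum, hsq⟩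

theorem polygonal_cast (m n : ℕ) : 2 * (polygonal m n : ℤ) = m * (n ^ 2 - n) + 2 * n := by
  have h : 2 * (m * (n * (n - 1)) / 2) = m * (n * (n - 1)) :=
    Nat.mul_div_cancel' ((Nat.even_mul_pred_self n).two_dvd.mul_left m)
  unfold polygonal
  push_cast
  have h' : (2 : ℤ) * ((m * (n * (n - 1)) / 2 : ℕ) : ℤ) = m * (n * (n - 1)) := by
    rw [← Nat.cast_ofNat, ← Nat.cast_mul, h]
    cases n <;> simp
  push_cast at h'
  linarith

theorem exists_lower {m N : ℤ} (hm : 3 ≤ m) (hN : 924 * m ^ 3 ≤ N) :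
    ∃ L : ℤ, 4 ≤ L ∧ 10 * N ≤ m * (L * (L - 3)) ∧ m * (L + 3 * m) ^ 2 ≤ 12 * N := by
  have hm3 : 0 < m ^ 3 := by positivity
  have hex : ∃ l : ℕ, 10 * N ≤ m * (((l : ℤ) + 4) * (l + 1)) := by
    refine ⟨(10 * N).toNat, ?_⟩
    rw [Int.toNat_of_nonneg (by linarith)]
    have hN0 : 0 ≤ 10 * N := by linarith
    generalize 10 * N = M at hN0
    have : M ≤ (M + 4) * (M + 1) := by nlinarith
    nlinarith
  classical
  refine ⟨Nat.find hex + 4, by omega, ?_, ?_⟩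
  · have := Nat.find_spec hex
    linarith
  · obtain ⟨l, hl⟩ : ∃ l, l = Nat.find hex := ⟨_, rfl⟩
    rw [← hl]
    have hlow : m * (l : ℤ) ^ 2 ≤ 10 * N := by
      rcases Nat.eq_zero_or_pos l with h0 | h0
      · rw [h0]; push_cast; linarith
      · have := Nat.find_min hex (m := l - 1) (by omega)
        rw [Nat.cast_sub h0] at this
        push Not at this
        push_cast at this
        nlinarith
    have hl0 : (0 : ℤ) ≤ l := by positivity
    have h5 : ((l : ℤ) + 4 + 3 * m) ^ 2 ≤ (l + 5 * m) ^ 2 := by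
      apply pow_le_pow_left₀ <;> linarith
    have h6 : 10 * ((l : ℤ) + 5 * m) ^ 2 ≤ 11 * l ^ 2 + 2750 * m ^ 2 := by
      nlinarith [sq_nonneg ((l : ℤ) - 50 * m)]
    have h7 : m * (10 * ((l : ℤ) + 4 + 3 * m) ^ 2) ≤ m * (11 * l ^ 2 + 2750 * m ^ 2) := by
      apply mul_le_mul_of_nonneg_left <;> linarith
    nlinarith

theorem sum_polygonal_1113 (m : ℕ) (hm : 3 ≤ m)
    (N : ℕ) (hN : 924 * m ^ 3 ≤ N) :
    ∃ x₁ x₂ x₃ x₄ : ℕ,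
      N = polygonal m x₁ + polygonal m x₂ + polygonal m x₃ + 3 * polygonal m x₄ := by
  have hm' : (3 : ℤ) ≤ m := by exact_mod_cast hm
  obtain ⟨L, hL4, hL1, hL2⟩ := exists_lower hm' (N := N) (by exact_mod_cast hN)
  obtain ⟨b0, e0, hb0, hb0', he0⟩ : ∃ b0 e0 : ℤ, L ≤ b0 ∧ b0 < L + m ∧ (N : ℤ) - b0 = m * e0 := by
    refine ⟨L + (N - L) % m, (N - L) / m, ?_, ?_, ?_⟩
    · have := Int.emod_nonneg ((N : ℤ) - L) (b := m) (by omega)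
      omega
    · have := Int.emod_lt_of_pos ((N : ℤ) - L) (b := m) (by omega)
      omega
    · have := Int.mul_ediv_add_emod ((N : ℤ) - L) m
      linarith
  obtain ⟨j, hj0, hj2, hj⟩ : ∃ j : ℤ, 0 ≤ j ∧ j ≤ 2 ∧
      ((b0 + m * j) % 3 ≠ 0 ∨ (b0 + m * j + 2 * (e0 - j)) % 3 = 2) := by
    by_cases c0 : (b0 + m * 0) % 3 ≠ 0 ∨ (b0 + m * 0 + 2 * (e0 - 0)) % 3 = 2
    · exact ⟨0, by norm_num, by norm_num, c0⟩
    by_cases c1 : (b0 + m * 1) % 3 ≠ 0 ∨ (b0 + m * 1 + 2 * (e0 - 1)) % 3 = 2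
    · exact ⟨1, by norm_num, by norm_num, c1⟩
    refine ⟨2, by norm_num, by norm_num, ?_⟩
    clear hL1 hL2 he0 hN
    push Not at c0 c1
    obtain ⟨c0, c0'⟩ := c0
    obtain ⟨c1, c1'⟩ := c1
    right
    have hm0 : (m : ℤ) % 3 = 0 := by omega
    have he3 : e0 % 3 = 0 ∨ e0 % 3 = 1 ∨ e0 % 3 = 2 := by omega
    rcases he3 with h | h | h <;> omega
  obtain ⟨b, hb⟩ : ∃ b, b = b0 + m * j := ⟨_, rfl⟩
  obtain ⟨e, he⟩ : ∃ e, e = e0 - j := ⟨_, rfl⟩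
  rw [← hb, ← he] at hj
  have hbe : (N : ℤ) - b = m * e := by rw [hb, he]; linarith
  have hbL : L ≤ b := by nlinarith
  have hbU : b ≤ L + 3 * m := by nlinarith
  have k1 : m * b ^ 2 ≤ 12 * (N : ℤ) := by
    have : b ^ 2 ≤ (L + 3 * m) ^ 2 := pow_le_pow_left₀ (by omega) hbU 2
    nlinarith
  have k2 : 10 * (N : ℤ) ≤ m * (b * (b - 3)) := by
    have : L * (L - 3) ≤ b * (b - 3) := by nlinarith
    nlinarith
  have hmpos : (0 : ℤ) < m := by omega
  obtain ⟨x, y, z, w, hx, hy, hz, hw, hs, hq⟩ := cauchy_aux (a := b + 2 * e) (b := b) (by omega) (by omega)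
    (by
      apply lt_of_mul_lt_mul_left _ hmpos.le
      nlinarith)
    (by
      apply lt_of_mul_lt_mul_left _ hmpos.le
      nlinarith) hj
  lift x to ℕ using hx
  lift y to ℕ using hy
  lift z to ℕ using hz
  lift w to ℕ using hw
  refine ⟨x, y, z, w, ?_⟩
  have : (2 : ℤ) * N = 2 * (polygonal m x + polygonal m y + polygonal m z + 3 * polygonal m w : ℤ) := by
    have p1 := polygonal_cast m x
    have p2 := polygonal_cast m y
    have p3 := polygonal_cast m z
    have p4 := polygonal_cast m w
    linear_combination 2 * hbe - p1 - p2 - p3 - 3 * p4 - m * hq + (m - 2) * hs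
  have : (N : ℤ) = (polygonal m x + polygonal m y + polygonal m z + 3 * polygonal m w : ℤ) := by linarith
  exact_mod_cast this
end
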